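/- arXiv:1104.2072 — 3 statements merged into one kernel-verified Lean document; each statement's English description precedes it below -/
import Mathlib

section
/- Let k : 2^X → ℕ be a solid assignment. Then 𝔹_k is coherent, i.e., dim 𝒟_k = #𝔹_k. -/
open MvPolynomial

noncomputable section

/-- The linear polynomial `p_x : t ↦ x ⬝ t`. -/
def pLin (n : ℕ) (x : Fin n → ℝ) : MvPolynomial (Fin n) ℝ :=
  ∑ i, MvPolynomial.C (x i) * MvPolynomial.X i

/-- `p_Z = ∏_{x ∈ Z} p_x` for a sub-multiset `Z` of the multiset indexed by `ι`. -/
def pProd (n : ℕ) {ι : Type} (v : ι → Fin n → ℝ) (Z : Finset ι) : MvPolynomial (Fin n) ℝ :=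
  ∏ a ∈ Z, pLin n (v a)

/-- `q_Z = ∏_{x ∈ Z} (p_x - λ_x)`. -/
def qProd (n : ℕ) {ι : Type} (v : ι → Fin n → ℝ) (lam : ι → ℝ) (Z : Finset ι) :
    MvPolynomial (Fin n) ℝ :=
  ∏ a ∈ Z, (pLin n (v a) - MvPolynomial.C (lam a))

/-- The pairing `⟨p,q⟩ = (p(∂)q)(0) = ∑_α α! p_α q_α`. -/
def pairing (n : ℕ) (p q : MvPolynomial (Fin n) ℝ) : ℝ :=
  ∑ α ∈ p.support, p.coeff α * q.coeff α * (α.prod fun _ e => (Nat.factorial e : ℝ))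

/-- `B` is a basis of the multiset: its vectors form a basis of `ℝ^n`. -/
def IsBasisSet (n : ℕ) {ι : Type} (v : ι → Fin n → ℝ) (B : Finset ι) : Prop :=
  LinearIndependent ℝ (fun b : B => v b) ∧ Submodule.span ℝ (v '' ↑B) = ⊤

/-- The ideal `𝒥_{𝔹'}` generated by the `p_Z` over all `Z` meeting every `B ∈ 𝔹'`. -/
def Jideal (n : ℕ) {ι : Type} [DecidableEq ι] (v : ι → Fin n → ℝ) (𝔹' : Set (Finset ι)) :
    Ideal (MvPolynomial (Fin n) ℝ) :=
  Ideal.span {p | ∃ Z : Finset ι, (∀ B ∈ 𝔹', (Z ∩ B).Nonempty) ∧ p = pProd n v Z}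

/-- The kernel space `𝒟_{𝔹'}`. -/
def Dspace (n : ℕ) {ι : Type} [DecidableEq ι] (v : ι → Fin n → ℝ) (𝔹' : Set (Finset ι)) :
    Submodule ℝ (MvPolynomial (Fin n) ℝ) where
  carrier := {f | ∀ g ∈ Jideal n v 𝔹', pairing n g f = 0}
  zero_mem' := by intro g _; simp [pairing]
  add_mem' := by
    intro a b ha hb g hg
    have h : pairing n g (a + b) = pairing n g a + pairing n g b := by
      simp only [pairing, MvPolynomial.coeff_add]
      rw [← Finset.sum_add_distrib]
      exact Finset.sum_congr rfl fun α _ => by ring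
    rw [h, ha g hg, hb g hg, add_zero]
  smul_mem' := by
    intro c f hf g hg
    have h : pairing n g (c • f) = c * pairing n g f := by
      simp only [pairing, MvPolynomial.coeff_smul, smul_eq_mul, Finset.mul_sum]
      exact Finset.sum_congr rfl fun α _ => by ring
    rw [h, hf g hg, mul_zero]

/-- A solid assignment `k : 2^X → ℕ`. -/
def Solid (n : ℕ) {ι : Type} (v : ι → Fin n → ℝ) (k : Finset ι → ℕ) : Prop :=
  ∀ Z Z' : Finset ι,
    Submodule.span ℝ (v '' ↑Z) ≤ Submodule.span ℝ (v '' ↑Z') → k Z ≤ k Z'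

/-- An incremental assignment. -/
def Incremental {ι : Type} [DecidableEq ι] (k : Finset ι → ℕ) : Prop :=
  ∀ (Z : Finset ι) (x : ι), k (insert x Z) ≤ k Z + 1

/-- `m(I) = k(I) + n - #I`. -/
def mVal (n : ℕ) {ι : Type} (k : Finset ι → ℕ) (I : Finset ι) : ℕ := k I + n - I.card

/-- `B ∩ X` for `B ⊆ X ∪ Y`. -/
def leftPart {ι : Type} [Fintype ι] [DecidableEq ι] {M : ℕ} (B : Finset (ι ⊕ Fin M)) :
    Finset ι :=
  Finset.univ.filter fun i => Sum.inl i ∈ B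

/-- `B ∩ Y` for `B ⊆ X ∪ Y`, as a set of indices in `Y`. -/
def rightPart {ι : Type} [Fintype ι] [DecidableEq ι] {M : ℕ} (B : Finset (ι ⊕ Fin M)) :
    Finset (Fin M) :=
  Finset.univ.filter fun j => Sum.inr j ∈ B

/-- `Y_i = {y_1, …, y_i}` as a set of indices. -/
def YFin {M : ℕ} (i : ℕ) : Finset (Fin M) := Finset.univ.filter fun j => (j : ℕ) < i

/-- `X ∪ Y_i` as a subset of the index set of `X ∪ Y`. -/
def XYup (ι : Type) [Fintype ι] [DecidableEq ι] (M : ℕ) (i : ℕ) : Finset (ι ⊕ Fin M) :=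
  Finset.univ.image Sum.inl ∪ (YFin (M := M) i).image Sum.inr

/-- `Y` is in general position in `X ∪ Y`: no `y ∈ Y` lies in the span of fewer than `n`
vectors of `(X ∪ Y) ∖ {y}`. -/
def GeneralPosition (n : ℕ) {ι : Type} [Fintype ι] [DecidableEq ι] {M : ℕ}
    (v : ι → Fin n → ℝ) (y : Fin M → Fin n → ℝ) : Prop :=
  ∀ (j : Fin M) (S : Finset (ι ⊕ Fin M)), Sum.inr j ∉ S → S.card < n →
    y j ∉ Submodule.span ℝ (Sum.elim v y '' ↑S)

/-- `𝔹_k : the bases `B` of `X ∪ Y` with `B ∩ Y ⊆ Y_{m(B ∩ X)}`. -/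
def Bk (n : ℕ) {ι : Type} [Fintype ι] [DecidableEq ι] (v : ι → Fin n → ℝ) {M : ℕ}
    (y : Fin M → Fin n → ℝ) (k : Finset ι → ℕ) : Set (Finset (ι ⊕ Fin M)) :=
  {B | IsBasisSet n (Sum.elim v y) B ∧
    ∀ j : Fin M, Sum.inr j ∈ B → (j : ℕ) < mVal n k (leftPart B)}

/-- The space `𝒫_k = ∑_{Z ⊆ X} p_{X∖Z} Π_{k(Z)}`. -/
def Pspace (n : ℕ) {ι : Type} [Fintype ι] [DecidableEq ι] (v : ι → Fin n → ℝ)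
    (k : Finset ι → ℕ) : Submodule ℝ (MvPolynomial (Fin n) ℝ) :=
  ⨆ Z : Finset ι,
    Submodule.map (LinearMap.mulLeft ℝ (pProd n v (Finset.univ \ Z)))
      (MvPolynomial.restrictTotalDegree (Fin n) ℝ (k Z))

/-- The constants `λ` are generic: each basis `B` determines a point `bp B` at which
`q_z` vanishes exactly when `z ∈ B`. -/
def Generic (n : ℕ) {ι : Type} (v : ι → Fin n → ℝ) (lam : ι → ℝ)
    (bp : Finset ι → Fin n → ℝ) : Prop :=
  ∀ B : Finset ι, IsBasisSet n v B →
    ∀ z : ι, MvPolynomial.eval (bp B) (pLin n (v z) - MvPolynomial.C (lam z)) = 0 ↔ z ∈ B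

/-- `x` is placable in `𝔹'`. -/
def Placable {ι : Type} [DecidableEq ι] (x : ι) (𝔹' : Set (Finset ι)) : Prop :=
  ∀ B ∈ 𝔹', ∃ a ∈ B, (insert x B).erase a ∈ 𝔹'

/-- `𝔹'` is placible. -/
inductive Placible {ι : Type} [DecidableEq ι] : Set (Finset ι) → Prop
  | singleton (B : Finset ι) : Placible {B}
  | split (𝔹' : Set (Finset ι)) (x : ι) (hx : Placable x 𝔹')
      (hne1 : {B ∈ 𝔹' | x ∈ B}.Nonempty) (hne2 : {B ∈ 𝔹' | x ∉ B}.Nonempty)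
      (hp1 : Placible {B ∈ 𝔹' | x ∈ B}) (hp2 : Placible {B ∈ 𝔹' | x ∉ B}) :
      Placible 𝔹'

/-- `X(I)` : the elements of `X ∖ I` not in the span of the earlier elements of `I`. -/
def XsetI (n : ℕ) {ι : Type} [Fintype ι] [DecidableEq ι] [LinearOrder ι]
    (v : ι → Fin n → ℝ) (I : Finset ι) : Finset ι := by
  classical
  exact Finset.univ.filter fun x =>
    x ∉ I ∧ v x ∉ Submodule.span ℝ (v '' {b | b ∈ I ∧ b < x})

/-- `X'(B)` for `B ⊆ X ∪ Y`, with the order on `X ∪ Y` putting `X` (with its own order)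
before `Y` (ordered as given). -/
def XprimeB (n : ℕ) {ι : Type} [Fintype ι] [DecidableEq ι] [LinearOrder ι] {M : ℕ}
    (v : ι → Fin n → ℝ) (y : Fin M → Fin n → ℝ) (B : Finset (ι ⊕ Fin M)) :
    Finset (ι ⊕ Fin M) := by
  classical
  exact Finset.univ.filter fun z =>
    z ∉ B ∧ Sum.elim v y z ∉ Submodule.span ℝ
      (Sum.elim v y '' {b | b ∈ B ∧ Sum.Lex (· < ·) (· < ·) b z})

/-- The least space `Π(Θ)`. -/
def leastSpace (n : ℕ) (Θ : Finset (Fin n → ℝ)) : Submodule ℝ (MvPolynomial (Fin n) ℝ) :=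
  Submodule.span ℝ
    {f | ∃ (c : (Fin n → ℝ) → ℝ) (J : ℕ),
      f = (Nat.factorial J : ℝ)⁻¹ • ∑ θ ∈ Θ, c θ • pLin n θ ^ J ∧ f ≠ 0 ∧
      ∀ j < J, ∑ θ ∈ Θ, c θ • pLin n θ ^ j = 0}

/-- The central space `𝒫(X)`, spanned by the `p_Z` over short `Z`. -/
def centralP (n : ℕ) {ι : Type} [Fintype ι] [DecidableEq ι] (v : ι → Fin n → ℝ) :
    Submodule ℝ (MvPolynomial (Fin n) ℝ) :=
  Submodule.span ℝ
    {p | ∃ Z : Finset ι, Submodule.span ℝ (v '' ↑(Finset.univ \ Z)) = ⊤ ∧ p = pProd n v Z}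

end

/-- Families obtained by successive placements (weak form, allowing empty families). -/
inductive Good {κ : Type} [DecidableEq κ] : Set (Finset κ) → Prop
  | empty : Good ∅
  | single (B : Finset κ) : Good {B}
  | split (F : Set (Finset κ)) (x : κ) (hx : ∀ B ∈ F, x ∉ B → ∃ a ∈ B, (insert x B).erase a ∈ F)
      (h1 : Good {B ∈ F | x ∈ B}) (h2 : Good {B ∈ F | x ∉ B}) : Good F

lemma pLin_homog (n : ℕ) (x : Fin n → ℝ) : (pLin n x).IsHomogeneous 1 := by
  unfold pLin
  apply MvPolynomial.IsHomogeneous.sum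
  intro i _
  simpa using (MvPolynomial.isHomogeneous_C (Fin n) (x i)).mul (MvPolynomial.isHomogeneous_X ℝ i)

lemma pLin_add (n : ℕ) (x y : Fin n → ℝ) : pLin n (x + y) = pLin n x + pLin n y := by
  simp [pLin, add_mul, Finset.sum_add_distrib]

lemma pLin_smul (n : ℕ) (c : ℝ) (x : Fin n → ℝ) : pLin n (c • x) = C c * pLin n x := by
  simp [pLin, Finset.mul_sum, mul_assoc]

lemma pLin_zero (n : ℕ) : pLin n 0 = 0 := by simp [pLin]

lemma pLin_single (n : ℕ) (i : Fin n) : pLin n (Pi.single i 1) = X i := by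
  unfold pLin
  rw [Finset.sum_eq_single i]
  · simp
  · intro b _ hb; simp [hb]
  · simp

lemma pProd_homog (n : ℕ) {κ : Type} (v : κ → Fin n → ℝ) (Z : Finset κ) :
    (pProd n v Z).IsHomogeneous Z.card := by
  have := MvPolynomial.IsHomogeneous.prod Z (fun a => pLin n (v a)) (fun _ => 1)
    (fun i _ => pLin_homog n (v i))
  simpa [pProd] using this

/-- The maximal ideal at the origin. -/
noncomputable def mIdeal (n : ℕ) : Ideal (MvPolynomial (Fin n) ℝ) := Ideal.span (Set.range X)

lemma X_mem_of_basis (n : ℕ) {κ : Type} (v : κ → Fin n → ℝ) (B : Finset κ)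
    (hB : IsBasisSet n v B) (I : Ideal (MvPolynomial (Fin n) ℝ))
    (h : ∀ b ∈ B, pLin n (v b) ∈ I) : mIdeal n ≤ I := by
  have key : ∀ x : Fin n → ℝ, pLin n x ∈ I := by
    intro x
    have hx : x ∈ Submodule.span ℝ (v '' ↑B) := by rw [hB.2]; trivial
    induction hx using Submodule.span_induction with
    | mem x hx => obtain ⟨b, hb, rfl⟩ := hx; exact h b hb
    | zero => rw [pLin_zero]; exact I.zero_mem
    | add x y _ _ h1 h2 => rw [pLin_add]; exact I.add_mem h1 h2
    | smul c x _ h1 => rw [pLin_smul]; exact I.mul_mem_left _ h1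
  unfold mIdeal
  rw [Ideal.span_le]
  rintro _ ⟨i, rfl⟩
  rw [← pLin_single]; exact key _

lemma upper (n : ℕ) {κ : Type} [Fintype κ] [DecidableEq κ] (v : κ → Fin n → ℝ)
    (F : Set (Finset κ)) (hF : Good F) (hb : ∀ B ∈ F, IsBasisSet n v B) :
    ∃ A : Finset (MvPolynomial (Fin n) ℝ), A.card ≤ F.ncard ∧
      (∀ a ∈ A, ∃ d, a.IsHomogeneous d) ∧
      (∀ f, ∃ g ∈ Submodule.span ℝ (A : Set (MvPolynomial (Fin n) ℝ)), f - g ∈ Jideal n v F) ∧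
      ∃ L, mIdeal n ^ L ≤ Jideal n v F := by
  classical
  induction hF with
  | empty =>
    have : Jideal n v ∅ = ⊤ := by
      rw [Ideal.eq_top_iff_one]
      exact Ideal.subset_span ⟨∅, by simp, by simp [pProd]⟩
    refine ⟨∅, by simp, by simp, ?_, 0, ?_⟩
    · intro f; exact ⟨0, Submodule.zero_mem _, by rw [this]; trivial⟩
    · rw [this]; exact le_top
  | single B =>
    have hm : mIdeal n ≤ Jideal n v {B} := by
      apply X_mem_of_basis n v B (hb B rfl)
      intro b hbB
      refine Ideal.subset_span ⟨{b}, ?_, by simp [pProd]⟩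
      intro B' hB'
      rw [Set.mem_singleton_iff] at hB'
      subst hB'
      exact ⟨b, by simp [hbB]⟩
    refine ⟨{1}, by simp, ?_, ?_, 1, by simpa using hm⟩
    · intro a ha
      rw [Finset.mem_singleton] at ha
      subst ha
      exact ⟨0, MvPolynomial.isHomogeneous_one _ _⟩
    · intro f
      refine ⟨C (f.coeff 0), ?_, hm ?_⟩
      · rw [← mul_one (C _), ← MvPolynomial.smul_eq_C_mul]
        exact Submodule.smul_mem _ _ (Submodule.subset_span (by simp))
      · unfold mIdeal
        rw [← Set.image_univ, MvPolynomial.mem_ideal_span_X_image]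
        intro m hm
        by_contra hcon
        push Not at hcon
        have : m = 0 := by ext i; exact hcon i trivial
        subst this
        simp at hm
  | split F x hx h1 h2 ih1 ih2 =>
    obtain ⟨A1, c1, hom1, s1, L1, l1⟩ := ih1 (fun B hB => hb B hB.1)
    obtain ⟨A2, c2, hom2, s2, L2, l2⟩ := ih2 (fun B hB => hb B hB.1)
    have hJ2 : ∀ g ∈ Jideal n v {B ∈ F | x ∉ B}, pLin n (v x) * g ∈ Jideal n v F := by
      intro g hg
      unfold Jideal at hg
      induction hg using Submodule.span_induction with
      | zero => simp
      | add a b _ _ ha hb => rw [mul_add]; exact Ideal.add_mem _ ha hb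
      | smul c a _ ha =>
        rw [smul_eq_mul, mul_left_comm]; exact Ideal.mul_mem_left _ _ ha
      | mem g hg =>
        obtain ⟨Z, hZ, rfl⟩ := hg
        by_cases hxZ : x ∈ Z
        · apply Ideal.mul_mem_left
          refine Ideal.subset_span ⟨Z, ?_, rfl⟩
          intro B hB
          by_cases hxB : x ∈ B
          · exact ⟨x, by simp [hxZ, hxB]⟩
          · exact hZ B ⟨hB, hxB⟩
        · refine Ideal.subset_span ⟨insert x Z, ?_, ?_⟩
          · intro B hB
            by_cases hxB : x ∈ B
            · exact ⟨x, by simp [hxB]⟩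
            · exact (hZ B ⟨hB, hxB⟩).mono
                (Finset.inter_subset_inter_right (Finset.subset_insert _ _))
          · simp [pProd, Finset.prod_insert hxZ]
    have hJ1 : ∀ g ∈ Jideal n v {B ∈ F | x ∈ B}, ∃ q, g - pLin n (v x) * q ∈ Jideal n v F := by
      intro g hg
      unfold Jideal at hg
      induction hg using Submodule.span_induction with
      | zero => exact ⟨0, by simp⟩
      | add a b _ _ ha hb =>
        obtain ⟨q, hq⟩ := ha
        obtain ⟨r, hr⟩ := hb
        refine ⟨q + r, ?_⟩
        have := Ideal.add_mem _ hq hr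
        convert this using 1; ring
      | smul c a _ ha =>
        obtain ⟨q, hq⟩ := ha
        refine ⟨c * q, ?_⟩
        have := Ideal.mul_mem_left _ c hq
        convert this using 1; rw [smul_eq_mul]; ring
      | mem g hg =>
        obtain ⟨Z, hZ, rfl⟩ := hg
        by_cases hxZ : x ∈ Z
        · refine ⟨pProd n v (Z.erase x), ?_⟩
          have : pProd n v Z = pLin n (v x) * pProd n v (Z.erase x) := by
            unfold pProd; rw [Finset.mul_prod_erase Z (fun a => pLin n (v a)) hxZ]
          rw [this, sub_self]; exact Ideal.zero_mem _
        · refine ⟨0, ?_⟩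
          rw [mul_zero, sub_zero]
          refine Ideal.subset_span ⟨Z, ?_, rfl⟩
          intro B hB
          by_cases hxB : x ∈ B
          · exact hZ B ⟨hB, hxB⟩
          · obtain ⟨a, ha, hBa⟩ := hx B hB hxB
            have hxa : x ≠ a := fun h => hxB (h ▸ ha)
            obtain ⟨z, hz⟩ := hZ _ ⟨hBa, by simp [hxa]⟩
            simp only [Finset.mem_inter, Finset.mem_erase, Finset.mem_insert] at hz
            obtain ⟨hzZ, hza, rfl | hzB⟩ := hz
            · exact absurd hzZ hxZ
            · exact ⟨z, by simp [hzZ, hzB]⟩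
    refine ⟨A1 ∪ A2.image (fun q => pLin n (v x) * q), ?_, ?_, ?_, L1 + L2, ?_⟩
    · have e := Set.ncard_inter_add_ncard_sdiff_eq_ncard F {B | x ∈ B} (Set.toFinite _)
      have e1 : F ∩ {B | x ∈ B} = {B ∈ F | x ∈ B} := rfl
      have e2 : F \ {B | x ∈ B} = {B ∈ F | x ∉ B} := rfl
      rw [e1, e2] at e
      have := Finset.card_union_le A1 (A2.image (fun q => pLin n (v x) * q))
      have := Finset.card_image_le (s := A2) (f := fun q => pLin n (v x) * q)
      omega
    · intro a ha
      rw [Finset.mem_union, Finset.mem_image] at ha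
      obtain ha | ⟨q, hq, rfl⟩ := ha
      · exact hom1 a ha
      · obtain ⟨d, hd⟩ := hom2 q hq
        exact ⟨1 + d, (pLin_homog n _).mul hd⟩
    · intro f
      obtain ⟨g1, hg1, hf1⟩ := s1 f
      obtain ⟨q, hq⟩ := hJ1 _ hf1
      obtain ⟨g2, hg2, hf2⟩ := s2 q
      refine ⟨g1 + pLin n (v x) * g2, Submodule.add_mem _ ?_ ?_, ?_⟩
      · exact Submodule.span_mono (by simp) hg1
      · have : pLin n (v x) * g2 ∈ (Submodule.span ℝ (A2 : Set (MvPolynomial (Fin n) ℝ))).map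
            (LinearMap.mulLeft ℝ (pLin n (v x))) := ⟨g2, hg2, rfl⟩
        rw [Submodule.map_span] at this
        refine Submodule.span_mono ?_ this
        rintro _ ⟨a, ha, rfl⟩
        simp only [Finset.coe_union, Finset.coe_image]
        exact Or.inr ⟨a, ha, rfl⟩
      · have := Ideal.add_mem _ hq (hJ2 _ hf2)
        convert this using 1; ring
    · rw [pow_add, Ideal.mul_le]
      intro r hr s hs
      obtain ⟨q, hq⟩ := hJ1 r (l1 hr)
      have h1 := Ideal.mul_mem_right s _ hq
      have h2 := Ideal.mul_mem_left _ q (hJ2 s (l2 hs))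
      have := Ideal.add_mem _ h1 h2
      convert this using 1; ring

/-- Polynomials of degree `< j`. -/
def Wd (n j : ℕ) : Submodule ℝ (MvPolynomial (Fin n) ℝ) where
  carrier := {f | ∀ α : Fin n →₀ ℕ, j ≤ Finsupp.degree α → f.coeff α = 0}
  zero_mem' := by intro α _; simp
  add_mem' := by intro a b ha hb α h; simp [ha α h, hb α h]
  smul_mem' := by intro c a ha α h; simp [ha α h]

lemma Wd_mono (n : ℕ) {i j : ℕ} (h : i ≤ j) : Wd n i ≤ Wd n j :=
  fun _ hf α hα => hf α (h.trans hα)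

lemma Wd_mul (n : ℕ) {i j : ℕ} {f g : MvPolynomial (Fin n) ℝ} (hf : f ∈ Wd n (i + 1))
    (hg : g ∈ Wd n j) : f * g ∈ Wd n (i + j) := by
  classical
  intro α hα
  rw [MvPolynomial.coeff_mul]
  apply Finset.sum_eq_zero
  rintro ⟨a, b⟩ hab
  rw [Finset.HasAntidiagonal.mem_antidiagonal] at hab
  simp only at hab ⊢
  have : Finsupp.degree a + Finsupp.degree b = Finsupp.degree α := by
    rw [← hab, map_add]
  by_cases h : i + 1 ≤ Finsupp.degree a
  · rw [hf a h, zero_mul]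
  · rw [hg b (by omega), mul_zero]

lemma Wd_of_homog (n d : ℕ) {f : MvPolynomial (Fin n) ℝ} (hf : f.IsHomogeneous d) :
    f ∈ Wd n (d + 1) := by
  intro α hα
  apply hf.coeff_eq_zero
  omega

lemma pq_mem (n : ℕ) {κ : Type} [DecidableEq κ] (v : κ → Fin n → ℝ) (lam : κ → ℝ)
    (Z : Finset κ) : pProd n v Z - qProd n v lam Z ∈ Wd n Z.card ∧
      qProd n v lam Z ∈ Wd n (Z.card + 1) := by
  induction Z using Finset.induction_on with
  | empty =>
    simp only [pProd, qProd, Finset.prod_empty, sub_self]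
    exact ⟨Submodule.zero_mem _, Wd_of_homog n 0 (MvPolynomial.isHomogeneous_one _ _)⟩
  | insert a Z ha ih =>
    obtain ⟨h1, h2⟩ := ih
    have hp : pLin n (v a) ∈ Wd n (1 + 1) := Wd_of_homog n 1 (pLin_homog n _)
    have hc : (C (lam a) : MvPolynomial (Fin n) ℝ) ∈ Wd n (0 + 1) :=
      Wd_of_homog n 0 (MvPolynomial.isHomogeneous_C _ _)
    rw [Finset.card_insert_of_notMem ha]
    have e1 : pProd n v (insert a Z) = pLin n (v a) * pProd n v Z := by
      simp [pProd, Finset.prod_insert ha]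
    have e2 : qProd n v lam (insert a Z) = (pLin n (v a) - C (lam a)) * qProd n v lam Z := by
      simp [qProd, Finset.prod_insert ha]
    constructor
    · have := Submodule.add_mem _ (Wd_mono n (by omega : _ ≤ Z.card + 1) (Wd_mul n hp h1))
        (Wd_mono n (by omega : _ ≤ Z.card + 1) (Wd_mul n hc h2))
      rw [e1, e2]
      convert this using 1; ring
    · rw [e2]
      refine Wd_mono n (by omega) (Wd_mul n (i := 1) (Submodule.sub_mem _ hp (Wd_mono n (by omega) hc)) h2)

lemma hom_X_mul (n j : ℕ) (i : Fin n) (h : MvPolynomial (Fin n) ℝ) :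
    homogeneousComponent (j + 1) (X i * h) = X i * homogeneousComponent j h := by
  classical
  ext α
  rw [coeff_homogeneousComponent, coeff_X_mul', coeff_X_mul', coeff_homogeneousComponent]
  by_cases hi : i ∈ α.support
  · simp only [hi, if_true]
    have : Finsupp.degree (α - Finsupp.single i 1) + 1 = Finsupp.degree α := by
      have h1 : α - Finsupp.single i 1 + Finsupp.single i 1 = α := by
        apply tsub_add_cancel_of_le
        rw [Finsupp.single_le_iff]
        rw [Finsupp.mem_support_iff] at hi; omega
      conv_rhs => rw [← h1, map_add]
      simp
    congr 1
    rw [← this]; simp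
  · simp [hi]

lemma hom_X_mul_zero (n : ℕ) (i : Fin n) (h : MvPolynomial (Fin n) ℝ) :
    homogeneousComponent 0 (X i * h) = 0 := by
  classical
  rw [homogeneousComponent_zero, coeff_X_mul']; simp

lemma lead (n : ℕ) {κ : Type} [DecidableEq κ] (v : κ → Fin n → ℝ) (lam : κ → ℝ)
    (F : Set (Finset κ)) (I : Ideal (MvPolynomial (Fin n) ℝ))
    (hI : ∀ Z : Finset κ, (∀ B ∈ F, (Z ∩ B).Nonempty) → qProd n v lam Z ∈ I)
    (h : MvPolynomial (Fin n) ℝ) (hh : h ∈ Jideal n v F) (j : ℕ) :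
    homogeneousComponent j h ∈ I.restrictScalars ℝ ⊔ Wd n j := by
  unfold Jideal at hh
  induction hh using Submodule.span_induction generalizing j with
  | zero => simp
  | add a b _ _ ha hb => rw [map_add]; exact Submodule.add_mem _ (ha j) (hb j)
  | mem g hg =>
    obtain ⟨Z, hZ, rfl⟩ := hg
    rw [homogeneousComponent_of_mem (n := Z.card)
      ((MvPolynomial.mem_homogeneousSubmodule _ _).2 (pProd_homog n v Z))]
    split_ifs with hj
    · subst hj
      rw [← sub_add_cancel (pProd n v Z) (qProd n v lam Z), add_comm]
      exact Submodule.add_mem_sup (hI Z hZ) (pq_mem n v lam Z).1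
    · exact Submodule.zero_mem _
  | smul a h _ ih =>
    rw [smul_eq_mul]
    clear * - ih
    induction a using MvPolynomial.induction_on generalizing h j with
    | C c =>
      rw [← smul_eq_C_mul, map_smul]; exact Submodule.smul_mem _ _ (ih j)
    | add p q hp hq => rw [add_mul, map_add]; exact Submodule.add_mem _ (hp h ih j) (hq h ih j)
    | mul_X p i hp =>
      rw [mul_assoc]
      refine hp (X i * h) ?_ j
      intro j
      cases j with
      | zero => rw [hom_X_mul_zero]; exact Submodule.zero_mem _
      | succ j =>
        rw [hom_X_mul]
        obtain ⟨a, ha, b, hb, e⟩ := Submodule.mem_sup.1 (ih j)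
        rw [← e, mul_add]
        refine Submodule.add_mem_sup (I.mul_mem_left _ ha) ?_
        exact Wd_mono n (by omega) (Wd_mul n (i := 1) (Wd_of_homog n 1 (isHomogeneous_X ℝ i)) hb)

lemma span_all (n : ℕ) (J I : Ideal (MvPolynomial (Fin n) ℝ))
    (hl : ∀ h ∈ J, ∀ j, homogeneousComponent j h ∈ I.restrictScalars ℝ ⊔ Wd n j)
    (A : Finset (MvPolynomial (Fin n) ℝ)) (hom : ∀ a ∈ A, ∃ d, a.IsHomogeneous d)
    (hs : ∀ f, ∃ g ∈ Submodule.span ℝ (A : Set (MvPolynomial (Fin n) ℝ)), f - g ∈ J)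
    (f : MvPolynomial (Fin n) ℝ) :
    f ∈ Submodule.span ℝ (A : Set (MvPolynomial (Fin n) ℝ)) ⊔ I.restrictScalars ℝ := by
  have key : ∀ j, Wd n j ≤ Submodule.span ℝ (A : Set (MvPolynomial (Fin n) ℝ)) ⊔
      I.restrictScalars ℝ := by
    intro j
    induction j with
    | zero =>
      intro f hf
      have : f = 0 := by ext α; simpa using hf α (Nat.zero_le _)
      rw [this]; exact Submodule.zero_mem _
    | succ j ih =>
      intro f hf
      obtain ⟨g, hg, hfg⟩ := hs f
      have h1 : homogeneousComponent j g ∈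
          Submodule.span ℝ (A : Set (MvPolynomial (Fin n) ℝ)) := by
        clear hfg
        induction hg using Submodule.span_induction with
        | zero => simp
        | add a b _ _ ha hb =>
          rw [map_add]; exact Submodule.add_mem _ ha hb
        | smul c a _ ha => rw [map_smul]; exact Submodule.smul_mem _ _ ha
        | mem a ha =>
          obtain ⟨d, hd⟩ := hom a ha
          rw [homogeneousComponent_of_mem (n := d)
            ((MvPolynomial.mem_homogeneousSubmodule _ _).2 hd)]
          split_ifs
          · exact Submodule.subset_span ha
          · exact Submodule.zero_mem _
      have h2 := hl _ hfg j
      have h3 : f - homogeneousComponent j f ∈ Wd n j := by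
        intro α hα
        rw [coeff_sub, coeff_homogeneousComponent]
        split_ifs with h
        · simp
        · rw [hf α (by omega)]; simp
      have h4 : (I.restrictScalars ℝ ⊔ Wd n j) ≤
          Submodule.span ℝ (A : Set (MvPolynomial (Fin n) ℝ)) ⊔ I.restrictScalars ℝ :=
        sup_le le_sup_right ih
      have := Submodule.add_mem _ (Submodule.add_mem _ (ih h3) (h4 h2))
        ((le_sup_left : _ ≤ Submodule.span ℝ (A : Set (MvPolynomial (Fin n) ℝ)) ⊔
          I.restrictScalars ℝ) h1)
      convert this using 1
      rw [map_sub]; ring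
  refine key (f.totalDegree + 1) ?_
  intro α hα
  apply coeff_eq_zero_of_totalDegree_lt
  change _ < Finsupp.degree α
  omega

lemma generic_exists (n : ℕ) {κ : Type} [Fintype κ] [DecidableEq κ] (v : κ → Fin n → ℝ) :
    ∃ (lam : κ → ℝ) (θ : Finset κ → Fin n → ℝ), ∀ B, IsBasisSet n v B →
      (∀ b ∈ B, v b ⬝ᵥ θ B = lam b) ∧ ∀ z ∉ B, v z ⬝ᵥ θ B ≠ lam z := by
  classical
  have hT : ∀ B : {B : Finset κ // IsBasisSet n v B}, ∃ T : (κ → ℝ) →ₗ[ℝ] (Fin n → ℝ),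
      (∀ l, ∀ b ∈ B.1, v b ⬝ᵥ T l = l b) ∧ (∀ z ∉ B.1, T (Pi.single z 1) = 0) := by
    rintro ⟨B, hB⟩
    let E : (Fin n → ℝ) →ₗ[ℝ] (B → ℝ) := LinearMap.pi fun b => dotProductBilin ℝ ℝ (v b)
    have hE : ∀ t b, E t b = v b ⬝ᵥ t := fun t b => rfl
    have hinj : Function.Injective E := by
      rw [injective_iff_map_eq_zero]
      intro t ht
      have : ∀ x : Fin n → ℝ, x ⬝ᵥ t = 0 := by
        intro x
        have hx : x ∈ Submodule.span ℝ (v '' ↑B) := by rw [hB.2]; trivial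
        induction hx using Submodule.span_induction with
        | mem x hx =>
          obtain ⟨b, hb, rfl⟩ := hx
          rw [← hE t ⟨b, hb⟩, ht]; rfl
        | zero => simp
        | add x y _ _ h1 h2 => rw [add_dotProduct, h1, h2, add_zero]
        | smul c x _ h1 => rw [smul_dotProduct, h1, smul_zero]
      exact dotProduct_self_eq_zero.1 (this t)
    have hcard : B.card = n := by
      have h1 := finrank_span_eq_card hB.1
      have h2 : Set.range (fun b : B => v b) = v '' ↑B := by
        ext; simp
      rw [h2, hB.2] at h1
      simpa using h1.symm
    have hsurj : Function.Surjective E :=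
      (LinearMap.injective_iff_surjective_of_finrank_eq_finrank (by simp [hcard])).1 hinj
    obtain ⟨R, hR⟩ := LinearMap.exists_rightInverse_of_surjective E (LinearMap.range_eq_top.2 hsurj)
    refine ⟨R ∘ₗ LinearMap.funLeft ℝ ℝ (fun b : B => (b : κ)), ?_, ?_⟩
    · intro l b hb
      rw [← hE _ ⟨b, hb⟩]
      have := congrArg (fun f => f (LinearMap.funLeft ℝ ℝ (fun b : B => (b : κ)) l)) hR
      exact congrFun this ⟨b, hb⟩
    · intro z hz
      have : LinearMap.funLeft ℝ ℝ (fun b : B => (b : κ)) (Pi.single z 1) = 0 := by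
        ext b
        have : (b : κ) ≠ z := fun h => hz (h ▸ b.2)
        simp [LinearMap.funLeft, this]
      simp only [LinearMap.comp_apply]
      rw [this, map_zero]
  choose T hT1 hT2 using hT
  let K := {p : {B : Finset κ // IsBasisSet n v B} × κ // p.2 ∉ p.1.1}
  obtain ⟨lam, hlam⟩ := Module.Dual.exists_forall_ne_zero_of_forall_exists (ι := K) (K := ℝ)
    (M := κ → ℝ)
    (fun p => dotProductBilin ℝ ℝ (v p.1.2) ∘ₗ T p.1.1 - LinearMap.proj p.1.2) (by
      rintro ⟨⟨B, z⟩, hz⟩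
      refine ⟨Pi.single z 1, ?_⟩
      simp [hT2 B z hz])
  refine ⟨lam, fun B => if h : IsBasisSet n v B then T ⟨B, h⟩ lam else 0, ?_⟩
  intro B hB
  simp only [hB, dif_pos]
  refine ⟨fun b hb => hT1 ⟨B, hB⟩ lam b hb, fun z hz h => ?_⟩
  apply hlam ⟨⟨⟨B, hB⟩, z⟩, hz⟩
  simp only [LinearMap.sub_apply, LinearMap.comp_apply, LinearMap.proj_apply]
  exact sub_eq_zero.2 h

lemma basis_card (n : ℕ) {κ : Type} (v : κ → Fin n → ℝ) (B : Finset κ)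
    (hB : IsBasisSet n v B) : B.card = n := by
  have h1 := finrank_span_eq_card hB.1
  have h2 : Set.range (fun b : B => v b) = v '' ↑B := by
    ext; simp
  rw [h2, hB.2] at h1
  simpa using h1.symm

lemma eval_pLin (n : ℕ) (x t : Fin n → ℝ) : eval t (pLin n x) = x ⬝ᵥ t := by
  simp [pLin, dotProduct]

lemma lower (n : ℕ) {κ : Type} [Fintype κ] [DecidableEq κ] (v : κ → Fin n → ℝ)
    (F : Set (Finset κ)) (hb : ∀ B ∈ F, IsBasisSet n v B)
    (A : Finset (MvPolynomial (Fin n) ℝ)) (hom : ∀ a ∈ A, ∃ d, a.IsHomogeneous d)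
    (hs : ∀ f, ∃ g ∈ Submodule.span ℝ (A : Set (MvPolynomial (Fin n) ℝ)),
      f - g ∈ Jideal n v F) : F.ncard ≤ A.card := by
  classical
  obtain ⟨lam, θ, hθ⟩ := generic_exists n v
  let ev : MvPolynomial (Fin n) ℝ →ₗ[ℝ] (F → ℝ) :=
    LinearMap.pi fun B => (aeval (R := ℝ) (θ B)).toLinearMap
  have hev : ∀ f B, ev f B = eval (θ B) f := fun f B => by
    simp [ev, aeval_eq_eval]
  let I : Ideal (MvPolynomial (Fin n) ℝ) :=
    { carrier := {f | ev f = 0}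
      zero_mem' := map_zero ev
      add_mem' := by
        intro a b ha hb
        simp only [Set.mem_ofPred_eq] at *
        rw [map_add, ha, hb, add_zero]
      smul_mem' := by
        intro c a ha
        simp only [Set.mem_ofPred_eq] at *
        ext B
        have := congrFun ha B
        rw [hev] at this ⊢
        simp only [smul_eq_mul, map_mul, this, mul_zero, Pi.zero_apply] }
  have hq : ∀ Z B, eval (θ B) (qProd n v lam Z) = ∏ z ∈ Z, (v z ⬝ᵥ θ B - lam z) := by
    intro Z B
    simp [qProd, map_prod, eval_pLin]
  have hI : ∀ Z : Finset κ, (∀ B ∈ F, (Z ∩ B).Nonempty) → qProd n v lam Z ∈ I := by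
    intro Z hZ
    change ev _ = 0
    ext B
    rw [hev, hq]
    obtain ⟨z, hz⟩ := hZ B B.2
    rw [Finset.mem_inter] at hz
    exact Finset.prod_eq_zero hz.1 (by rw [(hθ B (hb B B.2)).1 z hz.2, sub_self])
  have hall := span_all n (Jideal n v F) I (fun h hh j => lead n v lam F I hI h hh j) A hom hs
  have htop : Submodule.span ℝ (A.image ev : Set (F → ℝ)) = ⊤ := by
    rw [Finset.coe_image, ← Submodule.map_span]
    have hr : ∀ f, ev f ∈ Submodule.map ev (Submodule.span ℝ (A : Set _)) := by
      intro f
      obtain ⟨a, ha, b, hb, e⟩ := Submodule.mem_sup.1 (hall f)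
      have hb' : ev b = 0 := hb
      exact ⟨a, ha, by rw [← e, map_add, hb', add_zero]⟩
    rw [eq_top_iff, ← (Pi.basisFun ℝ F).span_eq, Submodule.span_le]
    rintro _ ⟨B, rfl⟩
    have hne : eval (θ B) (qProd n v lam (Finset.univ \ B)) ≠ 0 := by
      rw [hq, Finset.prod_ne_zero_iff]
      intro z hz
      exact sub_ne_zero.2 ((hθ B (hb B B.2)).2 z (by simpa using hz))
    have : (Pi.basisFun ℝ F) B = (eval (θ B) (qProd n v lam (Finset.univ \ B)))⁻¹ •
        ev (qProd n v lam (Finset.univ \ B)) := by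
      ext B'
      rw [Pi.smul_apply, hev]
      by_cases h : B' = B
      · subst h; simp [inv_mul_cancel₀ hne]
      · have h0 : eval (θ B') (qProd n v lam (Finset.univ \ B)) = 0 := by
          rw [hq]
          have : ¬ (B' : Finset κ) ⊆ B := by
            intro hsub
            apply h
            apply Subtype.ext
            apply Finset.eq_of_subset_of_card_le hsub
            rw [basis_card n v _ (hb B B.2), basis_card n v _ (hb B' B'.2)]
          obtain ⟨z, hz, hz'⟩ := Finset.not_subset.1 this
          exact Finset.prod_eq_zero (i := z) (by simp [hz'])
            (by rw [(hθ B' (hb B' B'.2)).1 z hz, sub_self])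
        simp [h0, h]
    rw [this]
    exact Submodule.smul_mem _ _ (hr _)
  have h1 := finrank_span_finset_le_card (R := ℝ) (A.image ev)
  rw [Set.finrank, htop, finrank_top, Module.finrank_fintype_fun_eq_card] at h1
  rw [← Nat.card_coe_set_eq, Nat.card_eq_fintype_card]
  exact h1.trans Finset.card_image_le

lemma pairing_eq (n : ℕ) (p q : MvPolynomial (Fin n) ℝ) :
    pairing n p q = (basisMonomials (Fin n) ℝ).constr ℝ
      (fun α => q.coeff α * (α.prod fun _ e => (Nat.factorial e : ℝ))) p := by
  rw [Module.Basis.constr_apply]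
  unfold pairing
  rw [Finsupp.sum]
  refine Finset.sum_congr rfl fun α _ => ?_
  rw [mul_assoc]; rfl

lemma fact_ne (n : ℕ) (α : Fin n →₀ ℕ) : (α.prod fun _ e => (Nat.factorial e : ℝ)) ≠ 0 := by
  unfold Finsupp.prod
  rw [Finset.prod_ne_zero_iff]
  intro i _
  exact Nat.cast_ne_zero.2 (Nat.factorial_ne_zero _)

lemma pow_monomial (n L : ℕ) (α : Fin n →₀ ℕ) (h : L ≤ Finsupp.degree α) :
    (monomial α (1 : ℝ)) ∈ mIdeal n ^ L := by
  apply Ideal.pow_le_pow_right h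
  rw [monomial_eq, map_one, one_mul, Finsupp.degree]
  simp only [Finsupp.prod]
  change _ ∈ mIdeal n ^ (∑ i ∈ α.support, α i)
  rw [← Finset.prod_pow_eq_pow_sum]
  apply Ideal.prod_mem_prod
  intro i _
  apply Ideal.pow_mem_pow
  exact Ideal.subset_span ⟨i, rfl⟩

lemma rank_D (n : ℕ) {κ : Type} [DecidableEq κ] (v : κ → Fin n → ℝ)
    (F : Set (Finset κ)) (L : ℕ) (hL : mIdeal n ^ L ≤ Jideal n v F) :
    Nonempty (Dspace n v F ≃ₗ[ℝ]
      Module.Dual ℝ (MvPolynomial (Fin n) ℝ ⧸ (Jideal n v F).restrictScalars ℝ)) := by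
  classical
  let Φ : Dspace n v F →ₗ[ℝ] ((Jideal n v F).restrictScalars ℝ).dualAnnihilator :=
    { toFun := fun f => ⟨(basisMonomials (Fin n) ℝ).constr ℝ
        (fun α => f.1.coeff α * (α.prod fun _ e => (Nat.factorial e : ℝ))), by
          rw [Submodule.mem_dualAnnihilator]
          intro g hg
          rw [← pairing_eq]
          exact f.2 g hg⟩
      map_add' := by
        intro f g
        apply Subtype.ext
        apply (basisMonomials (Fin n) ℝ).ext
        intro α
        simp [Module.Basis.constr_basis, add_mul, -coe_basisMonomials]
      map_smul' := by
        intro c f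
        apply Subtype.ext
        apply (basisMonomials (Fin n) ℝ).ext
        intro α
        simp [Module.Basis.constr_basis, mul_assoc, -coe_basisMonomials] }
  have hΦ : Function.Bijective Φ := by
    constructor
    · intro f g h
      apply Subtype.ext
      ext α
      have := congrArg (fun x => x.1 (basisMonomials (Fin n) ℝ α)) h
      simp only [Φ, LinearMap.coe_mk, AddHom.coe_mk, Module.Basis.constr_basis] at this
      exact mul_right_cancel₀ (fact_ne n α) this
    · rintro ⟨φ, hφ⟩
      rw [Submodule.mem_dualAnnihilator] at hφ
      let S : Finset (Fin n →₀ ℕ) := (Finset.range L).biUnion fun d =>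
        Finset.finsuppAntidiag Finset.univ d
      have hS : ∀ α, α ∈ S ↔ Finsupp.degree α < L := by
        intro α
        simp [S, Finsupp.degree_eq_sum]
      let f : MvPolynomial (Fin n) ℝ := ∑ α ∈ S, monomial α
        (φ (monomial α 1) / (α.prod fun _ e => (Nat.factorial e : ℝ)))
      have hf : ∀ α, f.coeff α * (α.prod fun _ e => (Nat.factorial e : ℝ))
          = φ (monomial α 1) := by
        intro α
        simp only [f, coeff_sum, coeff_monomial]
        rw [Finset.sum_ite_eq' S α]
        split_ifs with h
        · exact div_mul_cancel₀ _ (fact_ne n α)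
        · rw [hS, not_lt] at h
          rw [zero_mul, hφ _ (hL (pow_monomial n L α h))]
      have hc : (basisMonomials (Fin n) ℝ).constr ℝ
        (fun α => f.coeff α * (α.prod fun _ e => (Nat.factorial e : ℝ))) = φ := by
        apply (basisMonomials (Fin n) ℝ).ext
        intro α
        rw [Module.Basis.constr_basis, hf, coe_basisMonomials]
      refine ⟨⟨f, ?_⟩, Subtype.ext hc⟩
      intro g hg
      rw [pairing_eq, hc]
      exact hφ g hg
  exact ⟨(LinearEquiv.ofBijective Φ hΦ).trans
    (Submodule.dualQuotEquivDualAnnihilator _).symm⟩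

lemma coherent (n : ℕ) {κ : Type} [Fintype κ] [DecidableEq κ] (v : κ → Fin n → ℝ)
    (F : Set (Finset κ)) (hF : Good F) (hb : ∀ B ∈ F, IsBasisSet n v B) :
    Module.rank ℝ (Dspace n v F) = (F.ncard : Cardinal) := by
  classical
  obtain ⟨A, hc, hom, hs, L, hL⟩ := upper n v F hF hb
  obtain ⟨e⟩ := rank_D n v F L hL
  set J := (Jideal n v F).restrictScalars ℝ with hJ
  have hspan : ∀ A : Finset (MvPolynomial (Fin n) ℝ),
      (∀ f, ∃ g ∈ Submodule.span ℝ (A : Set (MvPolynomial (Fin n) ℝ)), f - g ∈ Jideal n v F) ↔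
      Submodule.span ℝ (J.mkQ '' A) = ⊤ := by
    intro A
    rw [← Submodule.map_span, eq_top_iff]
    constructor
    · intro h x _
      obtain ⟨f, rfl⟩ := J.mkQ_surjective x
      obtain ⟨g, hg, hfg⟩ := h f
      refine ⟨g, hg, ?_⟩
      exact ((Submodule.Quotient.eq J).2 hfg).symm
    · intro h f
      obtain ⟨g, hg, e⟩ := h (show J.mkQ f ∈ ⊤ from trivial)
      refine ⟨g, hg, ?_⟩
      exact (Submodule.Quotient.eq J).1 e.symm
  have htop := (hspan A).1 hs
  have hfin : Module.Finite ℝ (MvPolynomial (Fin n) ℝ ⧸ J) :=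
    ⟨⟨A.image J.mkQ, by rw [Finset.coe_image, htop]⟩⟩
  have hle : Module.finrank ℝ (MvPolynomial (Fin n) ℝ ⧸ J) ≤ F.ncard := by
    have h1 := finrank_span_finset_le_card (R := ℝ) (A.image J.mkQ)
    rw [Set.finrank, Finset.coe_image, htop, finrank_top] at h1
    exact h1.trans (Finset.card_image_le.trans hc)
  have hge : F.ncard ≤ Module.finrank ℝ (MvPolynomial (Fin n) ℝ ⧸ J) := by
    obtain ⟨b, hbA, hbs, hbi⟩ := exists_linearIndependent ℝ (J.mkQ '' (A : Set _))
    have hbf : b.Finite := (A.finite_toSet.image _).subset hbA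
    have hsec : ∀ x : b, ∃ a ∈ A, J.mkQ a = x := fun x => hbA x.2
    choose s hsA hs2 using hsec
    have := hbf.fintype
    let A' : Finset (MvPolynomial (Fin n) ℝ) := Finset.univ.image s
    have himg : J.mkQ '' A' = b := by
      ext x
      constructor
      · rintro ⟨a, ha, rfl⟩
        simp only [A', Finset.coe_image, Finset.coe_univ, Set.image_univ] at ha
        obtain ⟨y, rfl⟩ := ha
        rw [hs2]; exact y.2
      · intro hx
        exact ⟨s ⟨x, hx⟩, by simp [A'], hs2 _⟩
    have hA' := lower n v F hb A' (by
      intro a ha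
      simp only [A', Finset.mem_image, Finset.mem_univ, true_and] at ha
      obtain ⟨y, rfl⟩ := ha
      exact hom _ (hsA y)) ((hspan A').2 (by rw [himg, hbs, htop]))
    refine hA'.trans (Finset.card_image_le.trans ?_)
    rw [Finset.card_univ]
    exact hbi.fintype_card_le_finrank
  have hfr := le_antisymm hle hge
  have : Module.Finite ℝ (Dspace n v F) := Module.Finite.equiv e.symm
  rw [← Module.finrank_eq_rank, e.finrank_eq, Subspace.dual_finrank_eq, hfr]

lemma basis_of_indep_card (n : ℕ) {κ : Type} (w : κ → Fin n → ℝ) (B : Finset κ)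
    (hi : LinearIndepOn ℝ w (B : Set κ)) (hc : B.card = n) : IsBasisSet n w B := by
  refine ⟨hi, ?_⟩
  have h := LinearIndependent.span_eq_top_of_card_eq_finrank' hi (by simp [hc])
  rw [← h]; congr 1; ext; simp

lemma basis_of_span_card (n : ℕ) {κ : Type} (w : κ → Fin n → ℝ) (B : Finset κ)
    (hs : Submodule.span ℝ (w '' ↑B) = ⊤) (hc : B.card = n) : IsBasisSet n w B := by
  refine ⟨?_, hs⟩
  apply linearIndependent_of_top_le_span_of_card_eq_finrank
  · rw [← hs]
    apply le_of_eq; congr 1; ext; simp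
  · simp [hc]

section
variable (n : ℕ) {ι : Type} [Fintype ι] [DecidableEq ι] (v : ι → Fin n → ℝ) {M : ℕ}
  (y : Fin M → Fin n → ℝ)

lemma gp_insert (hgen : GeneralPosition n v y) (j : Fin M) (U : Finset (ι ⊕ Fin M))
    (hU : LinearIndepOn ℝ (Sum.elim v y) (U : Set (ι ⊕ Fin M))) (hj : Sum.inr j ∉ U)
    (hc : U.card < n) :
    LinearIndepOn ℝ (Sum.elim v y) ((insert (Sum.inr j) U : Finset (ι ⊕ Fin M)) :
      Set (ι ⊕ Fin M)) := by
  rw [Finset.coe_insert]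
  exact hU.insert (hgen j U hj hc)

lemma gp_union (hgen : GeneralPosition n v y) (Y' : Finset (Fin M)) (I : Finset ι)
    (hI : LinearIndepOn ℝ v (I : Set ι)) (hc : I.card + Y'.card ≤ n) :
    LinearIndepOn ℝ (Sum.elim v y) ((I.disjSum Y' : Finset (ι ⊕ Fin M)) :
      Set (ι ⊕ Fin M)) := by
  induction Y' using Finset.induction_on with
  | empty =>
    have : ((I.disjSum (∅ : Finset (Fin M)) : Finset (ι ⊕ Fin M)) : Set (ι ⊕ Fin M))
        = Sum.inl '' (I : Set ι) := by
      ext z; cases z <;> simp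
    rw [this]
    exact LinearIndepOn.image_of_comp Sum.inl (Sum.elim v y) hI
  | insert j Y' hj ih =>
    rw [Finset.card_insert_of_notMem hj] at hc
    have := gp_insert n v y hgen j _ (ih (by omega)) (by simpa using hj)
      (by rw [Finset.card_disjSum]; omega)
    convert this using 2
    ext z; cases z <;> simp

lemma left_right (B : Finset (ι ⊕ Fin M)) : (leftPart B).disjSum (rightPart B) = B := by
  ext z; cases z <;> simp [leftPart, rightPart]

lemma left_indep (B : Finset (ι ⊕ Fin M))
    (hB : LinearIndepOn ℝ (Sum.elim v y) (B : Set (ι ⊕ Fin M))) :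
    LinearIndepOn ℝ v (leftPart B : Set ι) := by
  have h1 : LinearIndepOn ℝ (Sum.elim v y) (Sum.inl '' (leftPart B : Set ι)) := by
    apply hB.mono
    rintro _ ⟨i, hi, rfl⟩
    simpa [leftPart] using hi
  exact h1.comp_of_image Sum.inl_injective.injOn

lemma span_left (B : Finset (ι ⊕ Fin M)) :
    Submodule.span ℝ (v '' (leftPart B : Set ι)) ≤
      Submodule.span ℝ (Sum.elim v y '' (B : Set (ι ⊕ Fin M))) := by
  apply Submodule.span_mono
  rintro _ ⟨i, hi, rfl⟩
  exact ⟨Sum.inl i, by simpa [leftPart] using hi, rfl⟩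

/-- Exchange inside the span. -/
lemma exchange (I S : Finset ι) (x : ι) (hS : S ⊆ I)
    (hxI : v x ∈ Submodule.span ℝ (v '' (I : Set ι)))
    (hxS : v x ∉ Submodule.span ℝ (v '' (S : Set ι))) :
    ∃ a ∈ I, a ∉ S ∧ v a ∈ Submodule.span ℝ (insert (v x) (v '' ((I.erase a : Finset ι) : Set ι))) := by
  classical
  obtain ⟨C, hC⟩ := Finset.exists_minimal (s := I.powerset.filter
    (fun C => S ⊆ C ∧ v x ∈ Submodule.span ℝ (v '' (C : Set ι)))) ⟨I, by simp [hS, hxI]⟩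
  have hC1 := hC.1
  simp only [Finset.mem_filter, Finset.mem_powerset] at hC1
  obtain ⟨hCI, hSC, hxC⟩ := hC1
  have : ¬ C ⊆ S := fun h => hxS (Submodule.span_mono (Set.image_mono (by exact_mod_cast h)) hxC)
  obtain ⟨a, haC, haS⟩ := Finset.not_subset.1 this
  refine ⟨a, hCI haC, haS, ?_⟩
  have hn : v x ∉ Submodule.span ℝ (v '' ((C.erase a : Finset ι) : Set ι)) := by
    intro h
    have := hC.2 (y := C.erase a) (by
      simp only [Finset.mem_filter, Finset.mem_powerset]
      exact ⟨(Finset.erase_subset _ _).trans hCI, fun s hs => Finset.mem_erase.2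
        ⟨fun e => haS (e ▸ hs), hSC hs⟩, h⟩) (Finset.erase_subset _ _)
    exact absurd (this haC) (by simp)
  have h1 : v x ∈ Submodule.span ℝ (insert (v a) (v '' ((C.erase a : Finset ι) : Set ι))) := by
    rw [← Set.image_insert_eq, ← Finset.coe_insert, Finset.insert_erase haC]
    exact hxC
  refine Submodule.span_mono ?_ (mem_span_insert_exchange h1 hn)
  apply Set.insert_subset_insert
  apply Set.image_mono
  exact_mod_cast Finset.erase_subset_erase a hCI

lemma place_X (hgen : GeneralPosition n v y) (k : Finset ι → ℕ) (hsolid : Solid n v k)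
    (S : Finset (ι ⊕ Fin M)) (hSY : ∀ j, Sum.inr j ∉ S) (B : Finset (ι ⊕ Fin M))
    (hB : B ∈ Bk n v y k) (hSB : S ⊆ B)
    (x : ι) (hxB : Sum.inl x ∉ B) (hxS : v x ∉ Submodule.span ℝ (v '' (leftPart S : Set ι))) :
    ∃ a ∈ B, a ∉ S ∧ (insert (Sum.inl x) B).erase a ∈ Bk n v y k := by
  obtain ⟨hbas, hm⟩ := hB
  have hcard := basis_card n _ B hbas
  have hlr : (leftPart B).card + (rightPart B).card = n := by
    rw [← Finset.card_disjSum, left_right, hcard]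
  have hxl : x ∉ leftPart B := by simpa [leftPart] using hxB
  have hcard' : ∀ a ∈ B, ((insert (Sum.inl x) B).erase a).card = n := by
    intro a ha
    rw [Finset.card_erase_of_mem (Finset.mem_insert_of_mem ha),
      Finset.card_insert_of_notMem hxB, hcard]; omega
  by_cases hx : v x ∈ Submodule.span ℝ (v '' (leftPart B : Set ι))
  · obtain ⟨a, haI, haS, hspan⟩ := exchange n v (leftPart B) (leftPart S) x
      (by intro i hi; simp only [leftPart, Finset.mem_filter, Finset.mem_univ, true_and] at hi ⊢
          exact hSB hi) hx hxS
    have haB : Sum.inl a ∈ B := by simpa [leftPart] using haI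
    have hxa : x ≠ a := fun h => hxB (h ▸ haB)
    have hleft : leftPart ((insert (Sum.inl x) B).erase (Sum.inl a)) =
        insert x ((leftPart B).erase a) := by
      ext i
      simp only [leftPart, Finset.mem_filter, Finset.mem_univ, true_and, Finset.mem_erase,
        Finset.mem_insert, Sum.inl.injEq, ne_eq]
      grind
    have hsp : Submodule.span ℝ (v '' (leftPart B : Set ι)) ≤
        Submodule.span ℝ (v '' ((insert x ((leftPart B).erase a) : Finset ι) : Set ι)) := by
      rw [Submodule.span_le]
      rintro _ ⟨i, hi, rfl⟩
      by_cases hia : i = a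
      · subst hia
        rw [Finset.coe_insert, Set.image_insert_eq]
        exact hspan
      · apply Submodule.subset_span
        refine ⟨i, ?_, rfl⟩
        simp only [Finset.coe_insert, Finset.coe_erase]
        exact Or.inr ⟨hi, hia⟩
    refine ⟨Sum.inl a, haB, by simpa [leftPart] using haS, ?_, ?_⟩
    · apply basis_of_span_card _ _ _ _ (hcard' _ haB)
      rw [eq_top_iff, ← hbas.2, Submodule.span_le]
      rintro _ ⟨z, hz, rfl⟩
      by_cases hza : z = Sum.inl a
      · subst hza
        have h1 := hsp (Submodule.subset_span ⟨a, haI, rfl⟩)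
        rw [← hleft] at h1
        exact span_left n v y _ h1
      · apply Submodule.subset_span
        refine ⟨z, ?_, rfl⟩
        simp only [Finset.coe_erase, Finset.coe_insert]
        exact ⟨Or.inr hz, hza⟩
    · intro j hj
      have hjB : Sum.inr j ∈ B := by simpa using hj
      have h1 := hm j hjB
      have h2 := hsolid _ _ hsp
      rw [hleft]
      have h3 : (insert x ((leftPart B).erase a)).card = (leftPart B).card := by
        rw [Finset.card_insert_of_notMem (by simp [hxl]), Finset.card_erase_add_one haI]
      unfold mVal at h1 ⊢
      omega
  · have hI := left_indep n v y B hbas.1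
    have hI' : LinearIndepOn ℝ v ((insert x (leftPart B) : Finset ι) : Set ι) := by
      rw [Finset.coe_insert]; exact hI.insert hx
    have hne : (rightPart B).Nonempty := by
      rw [Finset.nonempty_iff_ne_empty]
      intro h0
      rw [h0, Finset.card_empty] at hlr
      have := (basis_of_indep_card n v _ hI (by omega)).2
      exact hx (by rw [this]; trivial)
    obtain ⟨j, hj, hmax⟩ := (rightPart B).exists_max_image id hne
    have hjB : Sum.inr j ∈ B := by simpa [rightPart] using hj
    have hleft : leftPart ((insert (Sum.inl x) B).erase (Sum.inr j)) = insert x (leftPart B) := by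
      ext i; simp [leftPart]
    have hright : rightPart ((insert (Sum.inl x) B).erase (Sum.inr j)) = (rightPart B).erase j := by
      ext i; simp [rightPart]
    refine ⟨Sum.inr j, hjB, hSY j, ?_, ?_⟩
    · apply basis_of_indep_card _ _ _ _ (hcard' _ hjB)
      rw [← left_right ((insert (Sum.inl x) B).erase (Sum.inr j)), hleft, hright]
      apply gp_union n v y hgen _ _ hI'
      rw [Finset.card_insert_of_notMem hxl, Finset.card_erase_of_mem hj]
      have := Finset.card_pos.2 hne
      omega
    · intro i hi
      rw [Finset.mem_erase, Finset.mem_insert] at hi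
      have hiB : Sum.inr i ∈ B := by simpa using hi.2
      have hij : i ≠ j := fun h => hi.1 (by rw [h])
      have h1 := hmax i (by simpa [rightPart] using hiB)
      have h2 := hm j hjB
      have h3 : (i : ℕ) < j := lt_of_le_of_ne h1 (fun h => hij (Fin.ext h))
      have h4 := hsolid (leftPart B) (insert x (leftPart B)) (Submodule.span_mono
        (Set.image_mono (by simp)))
      rw [hleft]
      unfold mVal at h2 ⊢
      rw [Finset.card_insert_of_notMem hxl]
      omega

lemma place_Y (hgen : GeneralPosition n v y) (k : Finset ι → ℕ)
    (S : Finset (ι ⊕ Fin M)) (B B0 : Finset (ι ⊕ Fin M))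
    (hB : B ∈ Bk n v y k) (hSB : S ⊆ B) (hB0 : B0 ∈ Bk n v y k) (hSB0 : S ⊆ B0)
    (hl : ∀ i, Sum.inl i ∈ B → Sum.inl i ∈ S) (hl0 : ∀ i, Sum.inl i ∈ B0 → Sum.inl i ∈ S)
    (j : Fin M) (hj0 : Sum.inr j ∈ B0) (hj : Sum.inr j ∉ B) :
    ∃ a ∈ B, a ∉ S ∧ (insert (Sum.inr j) B).erase a ∈ Bk n v y k := by
  obtain ⟨hbas, hm⟩ := hB
  have hcard := basis_card n _ B hbas
  have hcard0 := basis_card n _ B0 hB0.1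
  have hlB : ∀ i, Sum.inl i ∈ B ↔ Sum.inl i ∈ S := fun i => ⟨hl i, fun h => hSB h⟩
  have hlB0 : ∀ i, Sum.inl i ∈ B0 ↔ Sum.inl i ∈ S := fun i => ⟨hl0 i, fun h => hSB0 h⟩
  have : ¬ B ⊆ S := by
    intro h
    have h1 : B ⊆ B0 := h.trans hSB0
    rw [Finset.eq_of_subset_of_card_le h1 (by omega)] at hj
    exact hj hj0
  obtain ⟨a, haB, haS⟩ := Finset.not_subset.1 this
  have haj : Sum.inr j ≠ a := fun h => hj (h ▸ haB)
  have hpos : 0 < B.card := Finset.card_pos.2 ⟨a, haB⟩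
  refine ⟨a, haB, haS, ?_, ?_⟩
  · rw [Finset.erase_insert_of_ne haj]
    apply basis_of_indep_card
    · apply gp_insert n v y hgen
      · exact LinearIndepOn.mono hbas.1 (by exact_mod_cast Finset.erase_subset a B)
      · simp [hj]
      · rw [Finset.card_erase_of_mem haB]; omega
    · rw [Finset.card_insert_of_notMem (by simp [hj]), Finset.card_erase_of_mem haB]; omega
  · intro i hi
    have hL : leftPart ((insert (Sum.inr j) B).erase a) = leftPart B := by
      ext i
      simp only [leftPart, Finset.mem_filter, Finset.mem_univ, true_and, Finset.mem_erase,
        Finset.mem_insert]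
      constructor
      · rintro ⟨_, h | h⟩
        · cases h
        · exact h
      · intro h
        exact ⟨fun e => haS (e ▸ hl i h), Or.inr h⟩
    have hL0 : leftPart B0 = leftPart B := by
      ext i; simp [leftPart, hlB, hlB0]
    rw [hL]
    rw [Finset.mem_erase, Finset.mem_insert] at hi
    obtain ⟨_, h | h⟩ := hi
    · have := hB0.2 j hj0
      rw [hL0] at this
      rw [Sum.inr.inj h]; exact this
    · exact hm i h

lemma good_sub (hgen : GeneralPosition n v y) (k : Finset ι → ℕ) (hsolid : Solid n v k)
    (m : ℕ) : ∀ S T : Finset (ι ⊕ Fin M), (Finset.univ \ (S ∪ T)).card = m →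
      ((∀ j, Sum.inr j ∉ S) ∨ (∀ i, Sum.inl i ∈ S ∪ T)) →
      Good {B | B ∈ Bk n v y k ∧ S ⊆ B ∧ ∀ z ∈ T, z ∉ B} := by
  induction m with
  | zero =>
    intro S T hc _
    rw [Finset.card_eq_zero, Finset.sdiff_eq_empty_iff_subset] at hc
    have hsub : {B | B ∈ Bk n v y k ∧ S ⊆ B ∧ ∀ z ∈ T, z ∉ B} ⊆ {S} := by
      rintro B ⟨_, h1, h2⟩
      refine Finset.Subset.antisymm ?_ h1
      intro z hz
      have := hc (Finset.mem_univ z)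
      rw [Finset.mem_union] at this
      exact this.resolve_right (fun h => h2 z h hz)
    rcases Set.subset_singleton_iff_eq.1 hsub with h | h
    · rw [h]; exact Good.empty
    · rw [h]; exact Good.single S
  | succ m ih =>
    intro S T hc hph
    set F := {B | B ∈ Bk n v y k ∧ S ⊆ B ∧ ∀ z ∈ T, z ∉ B} with hF
    have step : ∀ z, z ∉ S ∪ T →
        ((∀ j, Sum.inr j ∉ insert z S) ∨ (∀ i, Sum.inl i ∈ S ∪ T)) →
        (∀ B0 ∈ F, z ∈ B0 → ∀ B ∈ F, z ∉ B → ∃ a ∈ B, a ∉ S ∧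
          (insert z B).erase a ∈ Bk n v y k) → Good F := by
      intro z hz hph' hpl
      have hcd : ∀ U : Finset (ι ⊕ Fin M), U = insert z (S ∪ T) →
          (Finset.univ \ U).card = m := by
        rintro _ rfl
        rw [Finset.sdiff_insert, Finset.card_erase_of_mem (by simpa using hz), hc]; rfl
      have g1 := ih (insert z S) T (hcd _ (Finset.insert_union _ _ _)) (by
        rcases hph' with h | h
        · exact Or.inl h
        · right; intro i; rw [Finset.insert_union]; exact Finset.mem_insert_of_mem (h i))
      have g2 := ih S (insert z T) (hcd _ (Finset.union_insert _ _ _)) (by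
        rcases hph' with h | h
        · left; intro j hj; exact h j (Finset.mem_insert_of_mem hj)
        · right; intro i; rw [Finset.union_insert]; exact Finset.mem_insert_of_mem (h i))
      have e1 : {B | B ∈ Bk n v y k ∧ insert z S ⊆ B ∧ ∀ z ∈ T, z ∉ B} = {B ∈ F | z ∈ B} := by
        ext B
        constructor
        · rintro ⟨h1, h2, h3⟩
          rw [Finset.insert_subset_iff] at h2
          exact ⟨⟨h1, h2.2, h3⟩, h2.1⟩
        · rintro ⟨⟨h1, h2, h3⟩, h4⟩
          exact ⟨h1, Finset.insert_subset_iff.2 ⟨h4, h2⟩, h3⟩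
      have e2 : {B | B ∈ Bk n v y k ∧ S ⊆ B ∧ ∀ z' ∈ insert z T, z' ∉ B} =
          {B ∈ F | z ∉ B} := by
        ext B
        constructor
        · rintro ⟨h1, h2, h3⟩
          exact ⟨⟨h1, h2, fun t ht => h3 t (Finset.mem_insert_of_mem ht)⟩,
            h3 z (Finset.mem_insert_self _ _)⟩
        · rintro ⟨⟨h1, h2, h3⟩, h4⟩
          refine ⟨h1, h2, fun t ht => ?_⟩
          rcases Finset.mem_insert.1 ht with rfl | ht
          · exact h4
          · exact h3 t ht
      rw [e1] at g1
      rw [e2] at g2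
      by_cases hex : ∃ B0 ∈ F, z ∈ B0
      · obtain ⟨B0, hB0, hz0⟩ := hex
        refine Good.split F z ?_ g1 g2
        intro B hB hzB
        obtain ⟨a, haB, haS, hmem⟩ := hpl B0 hB0 hz0 B hB hzB
        refine ⟨a, haB, hmem, ?_, ?_⟩
        · intro s hs
          exact Finset.mem_erase.2 ⟨fun e => haS (e ▸ hs), Finset.mem_insert_of_mem (hB.2.1 hs)⟩
        · intro t ht h
          rw [Finset.mem_erase, Finset.mem_insert] at h
          rcases h.2 with rfl | h2
          · exact hz (Finset.mem_union_right _ ht)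
          · exact hB.2.2 t ht h2
      · have : {B ∈ F | z ∉ B} = F := by
          ext B
          exact ⟨fun h => h.1, fun h => ⟨h, fun hz => hex ⟨B, h, hz⟩⟩⟩
        rw [this] at g2
        exact g2
    by_cases hX : ∀ i, Sum.inl i ∈ S ∪ T
    · have hne : (Finset.univ \ (S ∪ T)).Nonempty := by
        rw [← Finset.card_pos]; omega
      obtain ⟨z, hz⟩ := hne
      have hz : z ∉ S ∪ T := by simpa using hz
      apply step z hz (Or.inr hX)
      intro B0 hB0 hz0 B hB hzB
      have hl : ∀ B ∈ F, ∀ i, Sum.inl i ∈ B → Sum.inl i ∈ S := by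
        intro B hB i hi
        exact (Finset.mem_union.1 (hX i)).resolve_right (fun h => hB.2.2 _ h hi)
      cases z with
      | inl i => exact absurd (hX i) hz
      | inr j =>
        exact place_Y n v y hgen k S B B0 hB.1 hB.2.1 hB0.1 hB0.2.1 (hl B hB) (hl B0 hB0) j hz0 hzB
    · have hSY := hph.resolve_right hX
      push Not at hX
      obtain ⟨x, hx⟩ := hX
      apply step (Sum.inl x) hx
      · left; intro j hj
        rw [Finset.mem_insert] at hj
        rcases hj with h | h
        · cases h
        · exact hSY j h
      · intro B0 hB0 hx0 B hB hxB
        apply place_X n v y hgen k hsolid S hSY B hB.1 hB.2.1 x hxB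
        intro hcon
        have hi : LinearIndepOn ℝ (Sum.elim v y) (insert (Sum.inl x) (S : Set (ι ⊕ Fin M))) := by
          apply LinearIndepOn.mono hB0.1.1.1
          exact Set.insert_subset hx0 (by exact_mod_cast hB0.2.1)
        rw [linearIndepOn_insert (by
          intro h; exact hx (Finset.mem_union_left _ (by exact_mod_cast h)))] at hi
        exact hi.2 (span_left n v y S hcon)

end

/-- For a solid assignment `k`, the collection `𝔹_k` is coherent:
`dim 𝒟_k = #𝔹_k`. -/
theorem statement0
    (n : ℕ) (hn : 1 ≤ n) (ι : Type) [Fintype ι] [DecidableEq ι]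
    (v : ι → Fin n → ℝ) (M : ℕ) (y : Fin M → Fin n → ℝ)
    (hspan : Submodule.span ℝ (Set.range (Sum.elim v y)) = ⊤)
    (hgen : GeneralPosition n v y)
    (k : Finset ι → ℕ) (hsolid : Solid n v k)
    (hM : ∀ I : Finset ι, (LinearIndependent ℝ fun i : I => v i) → mVal n k I ≤ M) :
    Module.rank ℝ (Dspace n (Sum.elim v y) (Bk n v y k)) = ((Bk n v y k).ncard : Cardinal) := by
  refine coherent n (Sum.elim v y) (Bk n v y k) ?_ (fun B hB => hB.1)
  have h := good_sub n v y hgen k hsolid _ ∅ ∅ rfl (Or.inl (by simp))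
  convert h using 1
  ext B
  simp
end

section
/- Let W be a finite multiset of vectors spanning ℝ^n and let 𝔹′ be an arbitrary nonempty subset of 𝔹(W). Then dim 𝒟_{𝔹′} ≥ #𝔹′. -/
open MvPolynomial

section Helpers

variable {n : ℕ}

theorem aux_eval_pLin (x t : Fin n → ℝ) : eval t (pLin n x) = ∑ i, x i * t i := by
  simp [pLin]

theorem aux_pLin_homog (x : Fin n → ℝ) : (pLin n x).IsHomogeneous 1 := by
  unfold pLin
  refine IsHomogeneous.sum _ _ _ fun i _ => ?_
  simpa using (isHomogeneous_C (Fin n) (x i)).mul (isHomogeneous_X ℝ i)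

theorem aux_pProd_homog {ι : Type} (v : ι → Fin n → ℝ) (Z : Finset ι) :
    (pProd n v Z).IsHomogeneous Z.card := by
  unfold pProd
  have := IsHomogeneous.prod Z (fun a => pLin n (v a)) (fun _ => 1) (fun a _ => aux_pLin_homog _)
  simpa using this

theorem aux_qProd_deg {ι : Type} (v : ι → Fin n → ℝ) (lam : ι → ℝ) (Z : Finset ι) :
    (qProd n v lam Z).totalDegree ≤ Z.card := by
  unfold qProd
  refine (totalDegree_finsetProd _ _).trans ?_
  calc _ ≤ ∑ a ∈ Z, 1 := Finset.sum_le_sum fun a _ => ?_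
    _ = _ := by simp
  refine (totalDegree_sub _ _).trans ?_
  simpa using (aux_pLin_homog (v a)).totalDegree_le

theorem aux_diff_deg {ι : Type} [DecidableEq ι] (v : ι → Fin n → ℝ) (lam : ι → ℝ) (Z : Finset ι) :
    pProd n v Z - qProd n v lam Z = 0 ∨ (pProd n v Z - qProd n v lam Z).totalDegree < Z.card := by
  induction Z using Finset.induction_on with
  | empty => left; simp [pProd, qProd]
  | insert a Z ha ih =>
    right
    have e : pProd n v (insert a Z) - qProd n v lam (insert a Z) =
        pLin n (v a) * (pProd n v Z - qProd n v lam Z) + C (lam a) * qProd n v lam Z := by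
      simp only [pProd, qProd, Finset.prod_insert ha]; ring
    rw [e, Finset.card_insert_of_notMem ha]
    have h1 : (C (lam a) * qProd n v lam Z).totalDegree ≤ Z.card := by
      refine (totalDegree_mul _ _).trans ?_
      simpa using aux_qProd_deg v lam Z
    have h2 : (pLin n (v a) * (pProd n v Z - qProd n v lam Z)).totalDegree ≤ Z.card := by
      rcases ih with h | h
      · simp [h]
      · refine (totalDegree_mul _ _).trans ?_
        have := (aux_pLin_homog (v a)).totalDegree_le
        omega
    have := totalDegree_add (pLin n (v a) * (pProd n v Z - qProd n v lam Z))
      (C (lam a) * qProd n v lam Z)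
    have := max_le h2 h1
    omega

/-- functional -/
noncomputable def auxEv {K : Type} [Fintype K] (θ : K → Fin n → ℝ) :
    (K → ℝ) →ₗ[ℝ] MvPolynomial (Fin n) ℝ →ₗ[ℝ] ℝ :=
  LinearMap.mk₂ ℝ (fun c f => ∑ k, c k * eval (θ k) f)
    (by intros; simp [add_mul, Finset.sum_add_distrib])
    (by intros; simp [mul_assoc, Finset.mul_sum])
    (by intros; simp [mul_add, Finset.sum_add_distrib])
    (by intros; simp [smul_eval, Finset.mul_sum]; refine Finset.sum_congr rfl fun _ _ => by ring)

theorem auxEv_apply {K : Type} [Fintype K] (θ : K → Fin n → ℝ) (c f) :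
    auxEv θ c f = ∑ k, c k * eval (θ k) f := rfl

/-- orders -/
noncomputable def auxV {K : Type} [Fintype K] (θ : K → Fin n → ℝ) (j : ℕ) :
    Submodule ℝ (K → ℝ) where
  carrier := {c | ∀ f : MvPolynomial (Fin n) ℝ, f.totalDegree < j → auxEv θ c f = 0}
  zero_mem' := by intro f _; simp
  add_mem' := by intro a b ha hb f hf; simp [ha f hf, hb f hf]
  smul_mem' := by intro a b hb f hf; simp [hb f hf]

noncomputable def auxFac (α : Fin n →₀ ℕ) : ℝ := α.prod fun _ e => (Nat.factorial e : ℝ)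

theorem auxFac_ne (α : Fin n →₀ ℕ) : auxFac α ≠ 0 := by
  unfold auxFac Finsupp.prod
  exact Finset.prod_ne_zero_iff.2 fun i _ => by positivity

/-- leading terms -/
noncomputable def auxL {K : Type} [Fintype K] (θ : K → Fin n → ℝ) (j : ℕ) :
    (K → ℝ) →ₗ[ℝ] MvPolynomial (Fin n) ℝ :=
  ∑ α ∈ Finset.finsuppAntidiag (Finset.univ : Finset (Fin n)) j,
    (monomial α) ∘ₗ ((auxFac α)⁻¹ • (auxEv θ).flip (monomial α 1))

theorem auxL_coeff {K : Type} [Fintype K] (θ : K → Fin n → ℝ) (j : ℕ) (c : K → ℝ)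
    (α : Fin n →₀ ℕ) :
    coeff α (auxL θ j c) = if α.degree = j then (auxFac α)⁻¹ * auxEv θ c (monomial α 1) else 0 := by
  classical
  simp only [auxL, LinearMap.sum_apply, coeff_sum, LinearMap.comp_apply, coeff_monomial,
    LinearMap.smul_apply, LinearMap.flip_apply, smul_eq_mul]
  rw [Finset.sum_ite_eq']
  congr 1
  simp [Finset.mem_finsuppAntidiag, Finsupp.degree_eq_sum]

theorem aux_pairing_L {K : Type} [Fintype K] (θ : K → Fin n → ℝ) (j : ℕ) (c : K → ℝ)
    (g : MvPolynomial (Fin n) ℝ) :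
    pairing n g (auxL θ j c) = auxEv θ c (homogeneousComponent j g) := by
  classical
  rw [homogeneousComponent_apply, map_sum, pairing, Finset.sum_filter]
  refine Finset.sum_congr rfl fun α _ => ?_
  rw [auxL_coeff]
  split_ifs with h
  · have : (monomial α (coeff α g) : MvPolynomial (Fin n) ℝ) = coeff α g • monomial α 1 := by
      simp [smul_monomial]
    rw [this, map_smul, smul_eq_mul]
    have := auxFac_ne α
    change coeff α g * _ * auxFac α = _
    field_simp
  · simp

theorem aux_hc_mul {p h : MvPolynomial (Fin n) ℝ} {m : ℕ} (hp : p.IsHomogeneous m) (j : ℕ) :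
    homogeneousComponent j (p * h) =
      if m ≤ j then p * homogeneousComponent (j - m) h else 0 := by
  conv_lhs => rw [← sum_homogeneousComponent h, Finset.mul_sum, map_sum]
  have : ∀ i, homogeneousComponent j (p * homogeneousComponent i h) =
      if m + i = j then p * homogeneousComponent i h else 0 := by
    intro i
    have := hp.mul (homogeneousComponent_isHomogeneous i h)
    rw [homogeneousComponent_of_mem this]
    simp [eq_comm]
  simp only [this]
  split_ifs with hm
  · by_cases hj : j - m < h.totalDegree + 1
    · rw [Finset.sum_eq_single (j - m)]
      · rw [if_pos (by omega)]
      · intro b _ hb; rw [if_neg (by omega)]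
      · intro hh; simp at hh; omega
    · rw [homogeneousComponent_eq_zero _ _ (by omega), mul_zero]
      refine Finset.sum_eq_zero fun i hi => ?_
      simp at hi
      rw [if_neg (by omega)]
  · exact Finset.sum_eq_zero fun i _ => by rw [if_neg (by omega)]

theorem aux_L_mem {K ι : Type} [Fintype K] [DecidableEq ι] (θ : K → Fin n → ℝ)
    (v : ι → Fin n → ℝ) (lam : ι → ℝ) (𝔹' : Set (Finset ι))
    (hq : ∀ k, ∃ B ∈ 𝔹', ∀ b ∈ B, eval (θ k) (pLin n (v b)) = lam b)
    (j : ℕ) (c : K → ℝ) (hc : c ∈ auxV θ j) : auxL θ j c ∈ Dspace n v 𝔹' := by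
  intro g hg
  rw [aux_pairing_L]
  suffices H : ∀ h, auxEv θ c (homogeneousComponent j (g * h)) = 0 by simpa using H 1
  unfold Jideal at hg
  induction hg using Submodule.span_induction with
  | zero => simp
  | add x y _ _ hx hy => intro h; simp [add_mul, hx, hy]
  | smul a x hx ih =>
    intro h
    have := ih (a * h)
    rwa [show x * (a * h) = a • x * h by simp; ring] at this
  | mem x hx =>
    obtain ⟨Z, hZ, rfl⟩ := hx
    intro h
    rw [aux_hc_mul (aux_pProd_homog v Z)]
    split_ifs with hm
    · set h' := homogeneousComponent (j - Z.card) h with hh'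
      have e : pProd n v Z * h' = qProd n v lam Z * h' + (pProd n v Z - qProd n v lam Z) * h' := by
        ring
      rw [e, map_add]
      have e1 : auxEv θ c (qProd n v lam Z * h') = 0 := by
        rw [auxEv_apply]
        refine Finset.sum_eq_zero fun k _ => ?_
        obtain ⟨B, hB, hb⟩ := hq k
        obtain ⟨b, hbb⟩ := hZ B hB
        rw [Finset.mem_inter] at hbb
        have : eval (θ k) (qProd n v lam Z) = 0 := by
          unfold qProd
          rw [map_prod]
          refine Finset.prod_eq_zero hbb.1 ?_
          simp [hb b hbb.2]
        simp [this]
      rw [e1, zero_add]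
      rcases aux_diff_deg v lam Z with h0 | h0
      · simp [h0]
      · apply hc
        have h1 := totalDegree_mul (pProd n v Z - qProd n v lam Z) h'
        have h2 := (homogeneousComponent_isHomogeneous (j - Z.card) h).totalDegree_le
        rw [← hh'] at h2
        omega
    · simp

/-- truncation -/
def auxE (D : Submodule ℝ (MvPolynomial (Fin n) ℝ)) (j : ℕ) :
    Submodule ℝ (MvPolynomial (Fin n) ℝ) where
  carrier := {f | f ∈ D ∧ ∀ α : Fin n →₀ ℕ, α.degree < j → coeff α f = 0}
  zero_mem' := ⟨D.zero_mem, by simp⟩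
  add_mem' := by
    intro a b ha hb
    exact ⟨D.add_mem ha.1 hb.1, fun α h => by simp [ha.2 α h, hb.2 α h]⟩
  smul_mem' := by
    intro a b hb
    exact ⟨D.smul_mem _ hb.1, fun α h => by simp [hb.2 α h]⟩

theorem aux_ker {K : Type} [Fintype K] (θ : K → Fin n → ℝ) (j : ℕ) (c : K → ℝ)
    (hc : c ∈ auxV θ j) (h0 : auxL θ j c = 0) : c ∈ auxV θ (j + 1) := by
  intro f hf
  rw [f.as_sum, map_sum]
  refine Finset.sum_eq_zero fun α hα => ?_
  have e : (monomial α (coeff α f) : MvPolynomial (Fin n) ℝ) = coeff α f • monomial α 1 := by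
    simp [smul_monomial]
  have hd : α.degree ≤ f.totalDegree := by
    rw [Finsupp.degree_apply]; exact le_totalDegree hα
  rw [e, map_smul]
  by_cases h : α.degree = j
  · have := auxL_coeff θ j c α
    rw [h0, if_pos h] at this
    have h3 := auxFac_ne α
    simp at this
    rcases this with h | h
    · exact absurd h h3
    · simp [h]
  · rw [hc, smul_zero]
    rw [totalDegree_monomial _ one_ne_zero]
    rw [Finsupp.degree_apply] at h hd
    change ∑ i ∈ α.support, α i < j
    omega

theorem aux_step {K : Type} [Fintype K] (θ : K → Fin n → ℝ)
    (D : Submodule ℝ (MvPolynomial (Fin n) ℝ)) (j : ℕ)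
    (hD : ∀ c ∈ auxV θ j, auxL θ j c ∈ D)
    (ih : Module.rank ℝ (auxV θ (j + 1)) ≤ Module.rank ℝ (auxE D (j + 1))) :
    Module.rank ℝ (auxV θ j) ≤ Module.rank ℝ (auxE D j) := by
  let φ := (auxL θ j).domRestrict (auxV θ j)
  rw [← LinearMap.rank_range_add_rank_ker φ]
  have h1 : Module.rank ℝ (LinearMap.ker φ) ≤ Module.rank ℝ (auxV θ (j + 1)) := by
    rw [(Submodule.equivMapOfInjective (auxV θ j).subtype (Submodule.injective_subtype _)
      (LinearMap.ker φ)).rank_eq]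
    apply Submodule.rank_mono
    rintro _ ⟨c, hc, rfl⟩
    exact aux_ker θ j c c.2 hc
  have hdisj : LinearMap.range φ ⊓ auxE D (j + 1) = ⊥ := by
    rw [eq_bot_iff]
    rintro _ ⟨⟨c, rfl⟩, hc⟩
    rw [Submodule.mem_bot]
    ext α
    change coeff α (auxL θ j c) = _
    by_cases h : α.degree < j + 1
    · exact hc.2 α h
    · rw [auxL_coeff, if_neg (by omega)]; simp
  calc _ ≤ Module.rank ℝ (LinearMap.range φ) + Module.rank ℝ (auxE D (j + 1)) :=
        add_le_add_right (h1.trans ih) _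
    _ = Module.rank ℝ ↥(LinearMap.range φ ⊔ auxE D (j + 1)) := by
        rw [← Submodule.rank_sup_add_rank_inf_eq, hdisj]; simp
    _ ≤ _ := by
        apply Submodule.rank_mono
        apply sup_le
        · rintro _ ⟨c, rfl⟩
          refine ⟨hD c c.2, fun α h => ?_⟩
          change coeff α (auxL θ j c) = _
          rw [auxL_coeff, if_neg (by omega)]
        · intro f hf
          exact ⟨hf.1, fun α h => hf.2 α (by omega)⟩

theorem aux_interp {K : Type} [Fintype K] [DecidableEq K] (θ : K → Fin n → ℝ)
    (hθ : Function.Injective θ) (k : K) :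
    ∃ f : MvPolynomial (Fin n) ℝ, eval (θ k) f ≠ 0 ∧ ∀ l, l ≠ k → eval (θ l) f = 0 := by
  refine ⟨∏ l ∈ Finset.univ.erase k,
    (pLin n (θ k - θ l) - C (∑ i, (θ k - θ l) i * θ l i)), ?_, ?_⟩
  · rw [map_prod, Finset.prod_ne_zero_iff]
    intro l hl h
    rw [Finset.mem_erase] at hl
    apply hl.1
    apply hθ
    rw [map_sub, aux_eval_pLin, eval_C, ← Finset.sum_sub_distrib] at h
    have h2 : ∀ i ∈ Finset.univ, (θ k - θ l) i * (θ k - θ l) i = 0 := by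
      rw [← Finset.sum_eq_zero_iff_of_nonneg (fun i _ => mul_self_nonneg _), ← h]
      refine Finset.sum_congr rfl fun i _ => ?_
      simp only [Pi.sub_apply]; ring
    funext i
    have := mul_self_eq_zero.1 (h2 i (Finset.mem_univ _))
    simp only [Pi.sub_apply] at this
    linarith
  · intro l hl
    rw [map_prod]
    refine Finset.prod_eq_zero (Finset.mem_erase.2 ⟨hl, Finset.mem_univ _⟩) ?_
    rw [map_sub, aux_eval_pLin, eval_C, sub_self]

theorem aux_V_bot {K : Type} [Fintype K] [DecidableEq K] (θ : K → Fin n → ℝ)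
    (hθ : Function.Injective θ) : ∃ J, auxV θ J = ⊥ := by
  choose f hf hf' using aux_interp θ hθ
  refine ⟨∑ k, ((f k).totalDegree + 1), ?_⟩
  rw [eq_bot_iff]
  intro c hc
  rw [Submodule.mem_bot]
  funext k
  have h1 := hc (f k) (by
    have := Finset.single_le_sum (f := fun k => (f k).totalDegree + 1) (s := Finset.univ)
      (fun _ _ => Nat.zero_le _) (Finset.mem_univ k)
    omega)
  rw [auxEv_apply, Finset.sum_eq_single k (fun l _ hl => by rw [hf' k l hl, mul_zero])
    (by simp)] at h1
  exact (mul_eq_zero.1 h1).resolve_right (hf k)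

theorem aux_rank {K : Type} [Fintype K] [DecidableEq K] (θ : K → Fin n → ℝ)
    (hθ : Function.Injective θ) (D : Submodule ℝ (MvPolynomial (Fin n) ℝ))
    (hD : ∀ j, ∀ c ∈ auxV θ j, auxL θ j c ∈ D) :
    (Fintype.card K : Cardinal) ≤ Module.rank ℝ D := by
  obtain ⟨J, hJ⟩ := aux_V_bot θ hθ
  have key : ∀ i j, i + j = J → Module.rank ℝ (auxV θ j) ≤ Module.rank ℝ (auxE D j) := by
    intro i
    induction i with
    | zero => intro j hj; obtain rfl : j = J := by omega
              rw [hJ]; simp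
    | succ i ih => intro j hj; exact aux_step θ D j (hD j) (ih (j + 1) (by omega))
  have h0 := key J 0 rfl
  have ht : auxV θ 0 = ⊤ := by
    rw [eq_top_iff]; intro c _ f hf; omega
  rw [ht, rank_top] at h0
  simp only [rank_fun'] at h0
  exact h0.trans (Submodule.rank_mono fun f hf => hf.1)

/-- dot products -/
noncomputable def auxM {ι : Type} (v : ι → Fin n → ℝ) (B : Finset ι) :
    (Fin n → ℝ) →ₗ[ℝ] (B → ℝ) :=
  LinearMap.pi fun b => dotProductBilin ℝ ℝ (v b)

theorem auxM_apply {ι : Type} (v : ι → Fin n → ℝ) (B : Finset ι) (x b) :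
    auxM v B x b = v b ⬝ᵥ x := rfl

theorem aux_card {ι : Type} (v : ι → Fin n → ℝ) (B : Finset ι) (h : IsBasisSet n v B) :
    B.card = n := by
  have h2 : ⊤ ≤ Submodule.span ℝ (Set.range (fun b : B => v b)) := by
    rw [← h.2]; apply Submodule.span_mono; rintro _ ⟨b, hb, rfl⟩; exact ⟨⟨b, hb⟩, rfl⟩
  have := Module.finrank_eq_card_basis (Module.Basis.mk h.1 h2)
  simpa using this.symm

theorem auxM_inj {ι : Type} (v : ι → Fin n → ℝ) (B : Finset ι) (h : IsBasisSet n v B) :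
    Function.Injective (auxM v B) := by
  rw [injective_iff_map_eq_zero]
  intro x hx
  have : ∀ y ∈ Submodule.span ℝ (v '' ↑B), y ⬝ᵥ x = 0 := by
    intro y hy
    induction hy using Submodule.span_induction with
    | zero => simp
    | add a b _ _ ha hb => simp [add_dotProduct, ha, hb]
    | smul a b _ hb => simp [smul_dotProduct, hb]
    | mem y hy =>
      obtain ⟨b, hb, rfl⟩ := hy
      exact congrFun hx ⟨b, hb⟩
  rw [h.2] at this
  exact dotProduct_self_eq_zero.1 (this x trivial)

theorem aux_T {ι : Type} (v : ι → Fin n → ℝ) (B : Finset ι) (h : IsBasisSet n v B) :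
    ∃ T : (ι → ℝ) →ₗ[ℝ] (Fin n → ℝ), ∀ lam, ∀ b ∈ B, v b ⬝ᵥ T lam = lam b := by
  have hc := aux_card v B h
  let e := LinearEquiv.ofInjectiveOfFinrankEq (auxM v B) (auxM_inj v B h) (by simp [hc])
  refine ⟨e.symm.toLinearMap ∘ₗ LinearMap.funLeft ℝ ℝ (fun b : B => (b : ι)), ?_⟩
  intro lam b hb
  have := congrFun (e.apply_symm_apply (LinearMap.funLeft ℝ ℝ (fun b : B => (b : ι)) lam)) ⟨b, hb⟩
  exact this

theorem aux_points {ι : Type} [Fintype ι] [DecidableEq ι] (v : ι → Fin n → ℝ)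
    (𝔹' : Set (Finset ι)) (hbas : ∀ B ∈ 𝔹', IsBasisSet n v B) :
    ∃ (lam : ι → ℝ) (θ : 𝔹' → Fin n → ℝ), Function.Injective θ ∧
      ∀ B : 𝔹', ∀ b ∈ B.1, v b ⬝ᵥ θ B = lam b := by
  choose T hT using fun B : 𝔹' => aux_T v B.1 (hbas B.1 B.2)
  let F : 𝔹' × ι → Module.Dual ℝ (ι → ℝ) := fun p =>
    LinearMap.proj p.2 - (dotProductBilin ℝ ℝ (v p.2)) ∘ₗ T p.1
  have hF : ∀ p lam, F p lam = lam p.2 - v p.2 ⬝ᵥ T p.1 lam := fun p lam => rfl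
  have : ∃ lam : ι → ℝ, ∀ p : 𝔹' × ι, p.2 ∉ p.1.1 → F p lam ≠ 0 := by
    by_contra! hcon
    let s : Set (𝔹' × ι) := {p | p.2 ∉ p.1.1}
    have hs : s.Finite := Set.toFinite _
    have := Subspace.biUnion_ne_univ_of_top_notMem
      (k := ℝ) (s := (hs.toFinset.image fun p => LinearMap.ker (F p))) (E := ι → ℝ) ?_
    · apply this
      rw [Set.eq_univ_iff_forall]
      intro lam
      obtain ⟨p, hp, hp2⟩ := hcon lam
      simp only [Set.mem_iUnion]
      exact ⟨_, by simp; exact ⟨_, _, _, hp, rfl⟩, hp2⟩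
    · intro hmem
      simp only [Finset.mem_image, Set.Finite.mem_toFinset] at hmem
      obtain ⟨p, hp, hp2⟩ := hmem
      have h1 : F p (Pi.single p.2 1) = 0 := by
        rw [← LinearMap.mem_ker, hp2]; trivial
      have h2 : T p.1 (Pi.single p.2 1) = 0 := by
        apply auxM_inj v p.1.1 (hbas _ p.1.2)
        rw [map_zero]
        funext b
        rw [auxM_apply, hT _ _ _ b.2]
        have : (b : ι) ≠ p.2 := fun h => hp (h ▸ b.2)
        simp [this]
      rw [hF, h2] at h1
      simp at h1
  obtain ⟨lam, hlam⟩ := this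
  refine ⟨lam, fun B => T B lam, ?_, fun B b hb => hT B lam b hb⟩
  intro B B' hBB
  by_contra hne
  have hsub : ¬ B'.1 ⊆ B.1 := by
    intro hs
    apply hne
    apply Subtype.ext
    exact (Finset.eq_of_subset_of_card_le hs (by
      rw [aux_card v _ (hbas _ B.2), aux_card v _ (hbas _ B'.2)])).symm
  obtain ⟨b, hb, hb'⟩ := Finset.not_subset.1 hsub
  apply hlam (B, b) hb'
  rw [hF]
  simp only at hBB ⊢
  rw [hBB, hT B' lam b hb, sub_self]

end Helpers

/-- For any nonempty collection `𝔹'` of bases of a spanning multiset `W`,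
`dim 𝒟_{𝔹'} ≥ #𝔹'`. -/
theorem statement1
    (n : ℕ) (hn : 1 ≤ n) (ι : Type) [Fintype ι] [DecidableEq ι]
    (v : ι → Fin n → ℝ)
    (hspan : Submodule.span ℝ (Set.range v) = ⊤)
    (𝔹' : Set (Finset ι)) (hne : 𝔹'.Nonempty)
    (hbas : ∀ B ∈ 𝔹', IsBasisSet n v B) :
    (𝔹'.ncard : Cardinal) ≤ Module.rank ℝ (Dspace n v 𝔹') := by
  classical
  obtain ⟨lam, θ, hθ, hv⟩ := aux_points v 𝔹' hbas
  have : Fintype 𝔹' := Fintype.ofFinite _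
  have := aux_rank θ hθ (Dspace n v 𝔹') fun j c hc =>
    aux_L_mem θ v lam 𝔹' (fun B => ⟨B.1, B.2, fun b hb => by
      rw [aux_eval_pLin]; exact hv B b hb⟩) j c hc
  rwa [← Nat.card_eq_fintype_card, Nat.card_coe_set_eq] at this
end

section
/- Let k be a solid assignment. Then dim 𝒫_k ≥ #𝔹_k. -/
open MvPolynomial

noncomputable section

namespace S5

lemma pLin_totalDegree (n : ℕ) (x : Fin n → ℝ) : (pLin n x).totalDegree ≤ 1 := by
  unfold pLin
  refine (totalDegree_finsetSum _ _).trans (Finset.sup_le fun i _ => ?_)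
  refine (totalDegree_mul _ _).trans ?_
  simp [totalDegree_C, totalDegree_X]

lemma pLin_ne_zero (n : ℕ) (x : Fin n → ℝ) (hx : x ≠ 0) : pLin n x ≠ 0 := by
  intro h
  apply hx
  funext i
  have := congrArg (MvPolynomial.eval (Pi.single i 1)) h
  simpa [pLin, Pi.single_apply] using this

lemma pLin_zero (n : ℕ) : pLin n 0 = 0 := by simp [pLin]

def pmap {n m : ℕ} (L : (Fin n → ℝ) →ₗ[ℝ] (Fin m → ℝ)) :
    MvPolynomial (Fin n) ℝ →ₐ[ℝ] MvPolynomial (Fin m) ℝ :=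
  aeval (fun i => pLin m (L (Pi.single i 1)))

lemma pmap_pLin {n m : ℕ} (L : (Fin n → ℝ) →ₗ[ℝ] (Fin m → ℝ)) (x : Fin n → ℝ) :
    pmap L (pLin n x) = pLin m (L x) := by
  have hx : L x = ∑ i, x i • L (Pi.single i 1) := by
    conv_lhs => rw [pi_eq_sum_univ' x]
    simp only [map_sum, map_smul]
  rw [hx]
  simp only [pLin, pmap, map_sum, map_mul, aeval_X, algHom_C, Finset.sum_apply, Pi.smul_apply,
    smul_eq_mul, algebraMap_eq, Finset.mul_sum, Finset.sum_mul]
  rw [Finset.sum_comm]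
  exact Finset.sum_congr rfl fun i _ => Finset.sum_congr rfl fun j _ => by ring

lemma pmap_totalDegree {n m : ℕ} (L : (Fin n → ℝ) →ₗ[ℝ] (Fin m → ℝ))
    (p : MvPolynomial (Fin n) ℝ) : (pmap L p).totalDegree ≤ p.totalDegree := by
  rw [pmap, aeval_def, eval₂_eq]
  refine (totalDegree_finsetSum _ _).trans (Finset.sup_le fun d hd => ?_)
  refine (totalDegree_mul _ _).trans ?_
  rw [algebraMap_eq, totalDegree_C, zero_add]
  refine (totalDegree_finsetProd _ _).trans ?_
  refine le_trans (Finset.sum_le_sum (g := fun i => d i) fun i _ => ?_) (le_totalDegree hd)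
  refine (totalDegree_pow _ _).trans ?_
  have := Nat.mul_le_mul_left (d i) (pLin_totalDegree m (L (Pi.single i 1)))
  simpa using this

lemma pmap_surj {n m : ℕ} (L : (Fin n → ℝ) →ₗ[ℝ] (Fin m → ℝ)) (hL : Function.Surjective L)
    (q : MvPolynomial (Fin m) ℝ) :
    ∃ p : MvPolynomial (Fin n) ℝ, p.totalDegree ≤ q.totalDegree ∧ pmap L p = q := by
  obtain ⟨s, hs⟩ := L.exists_rightInverse_of_surjective (LinearMap.range_eq_top.2 hL)
  refine ⟨pmap s q, pmap_totalDegree s q, ?_⟩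
  have : (pmap L).comp (pmap s) = AlgHom.id ℝ _ := by
    apply MvPolynomial.algHom_ext
    intro i
    have h1 : pmap s (X i) = pLin n (s (Pi.single i 1)) := by simp [pmap]
    have h2 : L (s (Pi.single i 1)) = Pi.single i 1 := LinearMap.congr_fun hs _
    simp only [AlgHom.comp_apply, h1, pmap_pLin, h2, AlgHom.id_apply]
    simp [pLin, Pi.single_apply]
  exact DFunLike.congr_fun this q

lemma exists_quot {n : ℕ} (x : Fin (n+1) → ℝ) (hx : x ≠ 0) :
    ∃ L : (Fin (n+1) → ℝ) →ₗ[ℝ] (Fin n → ℝ), Function.Surjective L ∧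
      LinearMap.ker L = Submodule.span ℝ {x} := by
  have h := Submodule.finrank_quotient_add_finrank (Submodule.span ℝ {x})
  rw [finrank_span_singleton hx, Module.finrank_fin_fun] at h
  have e : ((Fin (n+1) → ℝ) ⧸ Submodule.span ℝ {x}) ≃ₗ[ℝ] (Fin n → ℝ) :=
    LinearEquiv.ofFinrankEq _ _ (by rw [Module.finrank_fin_fun]; omega)
  refine ⟨e.toLinearMap ∘ₗ (Submodule.span ℝ {x}).mkQ, ?_, ?_⟩
  · exact e.surjective.comp (Submodule.mkQ_surjective _)
  · simp

lemma rank_restrict (n k : ℕ) :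
    (((k + n).choose n : ℕ) : Cardinal) ≤ Module.rank ℝ (restrictTotalDegree (Fin n) ℝ k) := by
  have hb : Module.rank ℝ (restrictTotalDegree (Fin n) ℝ k) =
      Cardinal.mk {s : Fin n →₀ ℕ | (s.sum fun _ e => e) ≤ k} :=
    ((basisRestrictSupport ℝ _).mk_eq_rank'').symm
  rw [hb]
  let T : Finset (Fin n →₀ ℕ) :=
    (Finset.range (k+1)).biUnion fun j => (Finset.univ : Finset (Fin n)).finsuppAntidiag j
  have hT : T.card = (k + n).choose n := by
    rw [Finset.card_biUnion]
    · simp only [Finset.card_finsuppAntidiag_nat_eq_multichoose, Finset.card_univ,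
        Fintype.card_fin]
      exact Nat.sum_range_multichoose k n
    · intro i _ j _ hij
      rw [Function.onFun, Finset.disjoint_left]
      intro f hf hg
      rw [Finset.mem_finsuppAntidiag] at hf hg
      exact hij (hf.1.symm.trans hg.1)
  rw [← hT, ← Cardinal.mk_coe_finset]
  apply Cardinal.mk_le_mk_of_subset
  intro f hf
  simp only [T, Finset.coe_biUnion, Set.mem_iUnion, Finset.mem_coe, Finset.mem_range,
    Finset.mem_finsuppAntidiag] at hf
  obtain ⟨j, hj, hf, _⟩ := hf
  change f.sum (fun _ e => e) ≤ k
  rw [Finsupp.sum_fintype _ _ (fun _ => rfl)]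
  exact hf.le.trans (by omega)

variable {ι : Type} [DecidableEq ι]

def Psub (n : ℕ) (v : ι → Fin n → ℝ) (k : Finset ι → ℕ) (S : Finset ι) :
    Submodule ℝ (MvPolynomial (Fin n) ℝ) :=
  ⨆ Z : Finset ι, ⨆ _ : Z ⊆ S,
    Submodule.map (LinearMap.mulLeft ℝ (pProd n v (S \ Z)))
      (restrictTotalDegree (Fin n) ℝ (k Z))

lemma mem_Psub {n : ℕ} {v : ι → Fin n → ℝ} {k : Finset ι → ℕ} {S Z : Finset ι} (hZ : Z ⊆ S)
    {q : MvPolynomial (Fin n) ℝ} (hq : q.totalDegree ≤ k Z) :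
    pProd n v (S \ Z) * q ∈ Psub n v k S := by
  refine Submodule.mem_iSup_of_mem Z (Submodule.mem_iSup_of_mem hZ ?_)
  exact ⟨q, (mem_restrictTotalDegree _ _ _).2 hq, rfl⟩

lemma Psub_le {n : ℕ} {v : ι → Fin n → ℝ} {k : Finset ι → ℕ} {S : Finset ι}
    {W : Submodule ℝ (MvPolynomial (Fin n) ℝ)}
    (h : ∀ Z ⊆ S, ∀ q : MvPolynomial (Fin n) ℝ, q.totalDegree ≤ k Z → pProd n v (S \ Z) * q ∈ W) :
    Psub n v k S ≤ W := by
  refine iSup_le fun Z => iSup_le fun hZ => ?_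
  rintro _ ⟨q, hq, rfl⟩
  exact h Z hZ q ((mem_restrictTotalDegree _ _ _).1 hq)

open Classical in
def cnt (n : ℕ) (v : ι → Fin n → ℝ) (k : Finset ι → ℕ) (S : Finset ι) : ℕ :=
  ∑ I ∈ S.powerset, if LinearIndepOn ℝ v (I : Set ι) then (mVal n k I).choose (n - I.card) else 0

lemma insert_sdiff_insert' {S Z : Finset ι} {a : ι} (ha : a ∉ S) :
    insert a S \ insert a Z = S \ Z := by
  ext x
  simp only [Finset.mem_sdiff, Finset.mem_insert]
  by_cases hx : x = a
  · subst hx; simp [ha]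
  · simp [hx]

lemma main (S : Finset ι) : ∀ (n : ℕ) (v : ι → Fin n → ℝ) (k : Finset ι → ℕ), Monotone k →
    ((cnt n v k S : ℕ) : Cardinal) ≤ Module.rank ℝ (Psub n v k S) := by
  classical
  induction S using Finset.induction_on with
  | empty =>
    intro n v k _
    have h1 : cnt n v k ∅ = (k ∅ + n).choose n := by
      simp [cnt, mVal]
    rw [h1]
    refine (rank_restrict n (k ∅)).trans (Submodule.rank_mono ?_)
    intro q hq
    have := mem_Psub (v := v) (k := k) (Finset.Subset.refl ∅) ((mem_restrictTotalDegree _ _ _).1 hq)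
    simpa [pProd] using this
  | insert a S ha ih =>
    intro n v k hk
    have hsplit : cnt n v k (insert a S) = cnt n v k S + ∑ I ∈ S.powerset,
        if LinearIndepOn ℝ v ((insert a I : Finset ι) : Set ι)
          then (mVal n k (insert a I)).choose (n - (insert a I).card) else 0 := by
      unfold cnt
      rw [Finset.sum_powerset_insert ha]
    by_cases hva : v a = 0
    · have h0 : (∑ I ∈ S.powerset,
        if LinearIndepOn ℝ v ((insert a I : Finset ι) : Set ι)
          then (mVal n k (insert a I)).choose (n - (insert a I).card) else 0) = 0 := by
        refine Finset.sum_eq_zero fun I _ => if_neg fun h => ?_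
        exact h.ne_zero (i := a) (by simp) hva
      rw [hsplit, h0, add_zero]
      refine (ih n v k hk).trans (Submodule.rank_mono (Psub_le fun Z hZ q hq => ?_))
      have := mem_Psub (v := v) (k := k) (Finset.insert_subset_insert a hZ)
        (hq.trans (hk (Finset.subset_insert a Z)))
      rwa [insert_sdiff_insert' ha] at this
    · obtain _ | n := n
      · exact absurd (Subsingleton.elim _ _) hva
      obtain ⟨L, hL, hker⟩ := exists_quot (v a) hva
      have hcontr : (∑ I ∈ S.powerset,
        if LinearIndepOn ℝ v ((insert a I : Finset ι) : Set ι)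
          then (mVal (n+1) k (insert a I)).choose (n + 1 - (insert a I).card) else 0) ≤
          cnt n (L ∘ v) (fun Z => k (insert a Z)) S := by
        refine Finset.sum_le_sum fun I hI => ?_
        have haI : a ∉ I := fun h => ha (Finset.mem_powerset.1 hI h)
        split_ifs with h1 h2
        · rw [Finset.card_insert_of_notMem haI]
          simp only [mVal, Finset.card_insert_of_notMem haI]
          apply le_of_eq
          congr 1 <;> omega
        · exfalso
          apply h2
          rw [Finset.coe_insert, linearIndepOn_insert (by simpa using haI)] at h1
          apply LinearIndependent.map h1.1
          rw [hker, Submodule.disjoint_span_singleton' hva]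
          have hr : (Set.range fun x : (I : Set ι) => v x) = v '' (I : Set ι) := by
            ext; simp
          rw [hr]
          exact h1.2
        · exact Nat.zero_le _
        · exact le_rfl
      have hmono : Monotone (fun Z => k (insert a Z)) := fun Z Z' h =>
        hk (Finset.insert_subset_insert a h)
      have ih1 := ih (n+1) v k hk
      have ih2 := ih n (L ∘ v) _ hmono
      let P := Psub (n+1) v k (insert a S)
      let f := (pmap L).toLinearMap.domRestrict P
      have hmapprod : ∀ Z, pmap L (pProd (n+1) v Z) = pProd n (L ∘ v) Z := by
        intro Z
        simp [pProd, map_prod, pmap_pLin]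
      have hrange : Psub n (L ∘ v) (fun Z => k (insert a Z)) S ≤ LinearMap.range f := by
        refine Psub_le fun Z hZ q hq => ?_
        obtain ⟨p, hp, rfl⟩ := pmap_surj L hL q
        have hm := mem_Psub (v := v) (k := k) (Finset.insert_subset_insert a hZ) (hp.trans hq)
        rw [insert_sdiff_insert' ha] at hm
        refine ⟨⟨_, hm⟩, ?_⟩
        change pmap L (pProd (n+1) v (S \ Z) * p) = _
        rw [map_mul, hmapprod]
      have hmul : ∀ p ∈ Psub (n+1) v k S, pLin (n+1) (v a) * p ∈ P := by
        have : Psub (n+1) v k S ≤ P.comap (LinearMap.mulLeft ℝ (pLin (n+1) (v a))) := by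
          refine Psub_le fun Z hZ q hq => ?_
          have hm := mem_Psub (v := v) (k := k) (hZ.trans (Finset.subset_insert a S)) hq
          have haZ : a ∉ Z := fun h => ha (hZ h)
          rw [Finset.insert_sdiff_of_notMem _ haZ, pProd, Finset.prod_insert (by simp [ha]),
            mul_assoc] at hm
          exact hm
        exact this
      have hkerle : Module.rank ℝ (Psub (n+1) v k S) ≤ Module.rank ℝ (LinearMap.ker f) := by
        let g : Psub (n+1) v k S →ₗ[ℝ] P :=
          (LinearMap.mulLeft ℝ (pLin (n+1) (v a))).restrict hmul
        let g' : Psub (n+1) v k S →ₗ[ℝ] LinearMap.ker f := g.codRestrict _ (by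
          intro p
          rw [LinearMap.mem_ker]
          change pmap L (pLin (n+1) (v a) * p) = 0
          have : L (v a) = 0 := by
            rw [← LinearMap.mem_ker, hker]; exact Submodule.mem_span_singleton_self _
          rw [map_mul, pmap_pLin, this, pLin_zero, zero_mul])
        refine LinearMap.rank_le_of_injective g' ?_
        intro p q hpq
        have : pLin (n+1) (v a) * (p : MvPolynomial (Fin (n+1)) ℝ) = pLin (n+1) (v a) * q :=
          congrArg (fun z : LinearMap.ker f => ((z : P) : MvPolynomial (Fin (n+1)) ℝ)) hpq
        exact Subtype.ext (mul_left_cancel₀ (pLin_ne_zero _ _ hva) this)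
      rw [hsplit]
      change _ ≤ Module.rank ℝ P
      rw [← LinearMap.rank_range_add_rank_ker f, add_comm, Nat.cast_add]
      refine add_le_add ?_ (ih1.trans hkerle)
      exact (Nat.cast_le.2 hcontr).trans (ih2.trans (Submodule.rank_mono hrange))

lemma count [Fintype ι] (n : ℕ) (v : ι → Fin n → ℝ) (M : ℕ) (y : Fin M → Fin n → ℝ)
    (k : Finset ι → ℕ) : (Bk n v y k).ncard ≤ cnt n v k Finset.univ := by
  classical
  let T : Finset ((_ : Finset ι) × Finset (Fin M)) :=
    (Finset.univ.filter fun I : Finset ι => LinearIndepOn ℝ v (I : Set ι)).sigma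
      fun I => (YFin (M := M) (mVal n k I)).powersetCard (n - I.card)
  have hT : T.card ≤ cnt n v k Finset.univ := by
    rw [Finset.card_sigma, cnt, Finset.powerset_univ, Finset.sum_filter]
    refine Finset.sum_le_sum fun I _ => ?_
    split_ifs
    · rw [Finset.card_powersetCard]
      apply Nat.choose_le_choose
      rw [← Finset.card_range (mVal n k I)]
      refine Finset.card_le_card_of_injOn (fun j => (j : ℕ)) ?_ ?_
      · intro j hj
        simpa [YFin] using hj
      · intro i _ j _ h
        exact Fin.ext h
    · exact le_rfl
  refine le_trans ?_ hT
  rw [← Set.ncard_coe_finset]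
  refine Set.ncard_le_ncard_of_injOn (fun B => ⟨leftPart B, rightPart B⟩) ?_ ?_ (Finset.finite_toSet _)
  · rintro B ⟨⟨hli, hsp⟩, hB⟩
    have hcard : B.card = n := by
      have h1 := finrank_span_eq_card hli
      have h2 : Set.range (fun b : B => Sum.elim v y b) = Sum.elim v y '' ↑B := by
        ext; simp
      rw [h2, hsp, finrank_top, Module.finrank_fin_fun, Fintype.card_coe] at h1
      exact h1.symm
    have hsum : B.card = (leftPart B).card + (rightPart B).card := by
      have : B = (leftPart B).disjSum (rightPart B) := by
        ext x; rcases x with x | x <;> simp [leftPart, rightPart]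
      conv_lhs => rw [this]
      rw [Finset.card_disjSum]
    simp only [T, Finset.coe_sigma, Set.mem_sigma_iff, Finset.mem_coe, Finset.mem_filter,
      Finset.mem_univ, true_and, Finset.mem_powersetCard]
    refine ⟨?_, ?_, by omega⟩
    · exact hli.comp (fun i : ((leftPart B : Finset ι) : Set ι) =>
        (⟨Sum.inl i.1, by have := i.2; simpa [leftPart] using this⟩ : B)) (by
          intro i j h
          exact Subtype.ext (Sum.inl_injective (congrArg Subtype.val h)))
    · intro j hj
      simp only [rightPart, Finset.mem_filter, Finset.mem_univ, true_and] at hj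
      simpa [YFin] using hB j hj
  · intro B _ B' _ h
    simp only [Sigma.mk.injEq, heq_eq_eq] at h
    ext x
    rcases x with x | x
    · simpa [leftPart] using Finset.ext_iff.1 h.1 x
    · simpa [rightPart] using Finset.ext_iff.1 h.2 x

end S5

end

/-- for a solid assignment, `dim 𝒫_k ≥ #𝔹_k`. -/
theorem statement5
    (n : ℕ) (hn : 1 ≤ n) (ι : Type) [Fintype ι] [DecidableEq ι]
    (v : ι → Fin n → ℝ) (M : ℕ) (y : Fin M → Fin n → ℝ)
    (hspan : Submodule.span ℝ (Set.range (Sum.elim v y)) = ⊤)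
    (hgen : GeneralPosition n v y)
    (k : Finset ι → ℕ) (hsolid : Solid n v k)
    (hM : ∀ I : Finset ι, (LinearIndependent ℝ fun i : I => v i) → mVal n k I ≤ M) :
    ((Bk n v y k).ncard : Cardinal) ≤ Module.rank ℝ (Pspace n v k) := by
  have hk : Monotone k := fun Z Z' h =>
    hsolid Z Z' (Submodule.span_mono (Set.image_mono (by exact_mod_cast h)))
  refine (Nat.cast_le.2 (S5.count n v M y k)).trans ((S5.main Finset.univ n v k hk).trans ?_)
  apply Submodule.rank_mono
  exact iSup_mono fun Z => iSup_le fun _ => le_rfl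
end
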